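/- Let μ_N = √(2N+1) and define ψ_τ(s) = (2N)^{1/4} τ_N φ_{N−1}(μ_N + τ_N s). For every real s_L there exist constants C > 0 and N₀ ∈ ℕ such that for all N ≥ N₀ and all s ≥ s_L the improper integrals below converge and |∫_s^∞ ψ_τ(u) du − ∫_s^∞ Ai(u) du + Δ_N Ai(s)| ≤ C N^{−2/3} e^{−s/2}; moreover |∫_s^∞ ψ_τ(u) du| ≤ C e^{−s}. -/

import Mathlib

open Real Filter MeasureTheory

/-- Physicists' Hermite polynomial `H_n(x) = (-1)^n e^{x²} (d^n/dx^n) e^{-x²}`. -/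
noncomputable def physHermite (n : ℕ) (x : ℝ) : ℝ :=
  (-1 : ℝ) ^ n * Real.exp (x ^ 2) * iteratedDeriv n (fun t : ℝ => Real.exp (-t ^ 2)) x

/-- Normalizing constant `h_n = √π 2^n n!`. -/
noncomputable def hNorm (n : ℕ) : ℝ := Real.sqrt Real.pi * 2 ^ n * (n.factorial : ℝ)

/-- Oscillator wave function `φ_n(x) = h_n^{-1/2} e^{-x²/2} H_n(x)`. -/
noncomputable def osc (n : ℕ) (x : ℝ) : ℝ :=
  hNorm n ^ (-(1 : ℝ) / 2) * Real.exp (-x ^ 2 / 2) * physHermite n x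

/-- Airy function `Ai(x) = π⁻¹ lim_{R→∞} ∫₀^R cos(t³/3 + xt) dt`. -/
noncomputable def Ai (x : ℝ) : ℝ :=
  Real.pi⁻¹ *
    limUnder Filter.atTop (fun R : ℝ => ∫ t in (0 : ℝ)..R, Real.cos (t ^ 3 / 3 + x * t))

/-- Scaling constant `τ_N = 2^{-1/2} N^{-1/6}`. -/
noncomputable def tauN (N : ℕ) : ℝ := (2 : ℝ) ^ (-(1 : ℝ) / 2) * (N : ℝ) ^ (-(1 : ℝ) / 6)

/-- `Δ_N = (√(2N+1) - √(2N-1))/τ_N`. -/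
noncomputable def DeltaN (N : ℕ) : ℝ :=
  (Real.sqrt (2 * N + 1) - Real.sqrt (2 * N - 1)) / tauN N

/-- `ψ_τ(s) = (2N)^{1/4} τ_N φ_{N-1}(√(2N+1) + τ_N s)`. -/
noncomputable def psiTauR (N : ℕ) (s : ℝ) : ℝ :=
  (2 * N : ℝ) ^ ((1 : ℝ) / 4) * tauN N * osc (N - 1) (Real.sqrt (2 * N + 1) + tauN N * s)

/-- Polynomial growth on a vertical line is absorbed by a Gaussian. -/
lemma norm_vertical_pow_le (a : ℝ) {b : ℝ} (hb : 0 < b) (k : ℕ) (v : ℝ) :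
    ‖(a + v * Complex.I : ℂ)‖ ^ k ≤
      k.factorial * Real.exp (|a| + 1 / (4 * b)) * Real.exp (b * v ^ 2) := by
  have h1 : ‖(a + v * Complex.I : ℂ)‖ ≤ |a| + |v| := by
    refine (norm_add_le _ _).trans (le_of_eq ?_)
    simp
  have h2 := pow_div_factorial_le_exp (|a| + |v|) (by positivity) k
  rw [div_le_iff₀ (by positivity)] at h2
  have h3 : |v| ≤ 1 / (4 * b) + b * v ^ 2 := by
    rw [div_add' _ _ _ (by positivity), le_div_iff₀ (by positivity), ← sq_abs v]
    nlinarith [sq_nonneg (2 * b * |v| - 1)]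
  calc _ ≤ (|a| + |v|) ^ k := by gcongr
    _ ≤ Real.exp (|a| + |v|) * k.factorial := h2
    _ ≤ Real.exp (|a| + (1 / (4 * b) + b * v ^ 2)) * k.factorial := by gcongr
    _ = _ := by rw [← add_assoc, Real.exp_add]; ring

/-- A continuous function with Gaussian decay has integrable polynomial moments along a
vertical line. -/
lemma integrable_vertical_moment {g : ℝ → ℂ} (hg : Continuous g) {b K : ℝ} (hb : 0 < b)
    (hgb : ∀ v, ‖g v‖ ≤ K * Real.exp (-b * v ^ 2)) (a : ℝ) (k : ℕ) (s : ℝ) :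
    Integrable (fun v : ℝ => (a + v * Complex.I : ℂ) ^ k *
      Complex.exp (-s * (a + v * Complex.I)) * g v) := by
  have hI := (integrable_exp_neg_mul_sq (half_pos hb)).const_mul
    (k.factorial * Real.exp (|a| + 1 / (4 * (b / 2))) * Real.exp (-s * a) * K)
  refine hI.mono' (by fun_prop) (Eventually.of_forall fun v => ?_)
  rw [norm_mul, norm_mul, norm_pow, Complex.norm_exp]
  have hre : (-(s : ℂ) * (a + v * Complex.I)).re = -s * a := by simp
  rw [hre]
  calc _ ≤ (k.factorial * Real.exp (|a| + 1 / (4 * (b / 2))) * Real.exp (b / 2 * v ^ 2)) *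
        Real.exp (-s * a) * (K * Real.exp (-b * v ^ 2)) := by
        gcongr
        · exact norm_vertical_pow_le a (half_pos hb) k v
        · exact hgb v
    _ = k.factorial * Real.exp (|a| + 1 / (4 * (b / 2))) * Real.exp (-s * a) * K *
        (Real.exp (b / 2 * v ^ 2) * Real.exp (-b * v ^ 2)) := by ring
    _ = _ := by rw [← Real.exp_add]; congr 2; ring

/-- The `k`-th moment of the exponential integral of `g` along the line `Re z = a`. -/
noncomputable def verticalMoment (g : ℝ → ℂ) (a : ℝ) (k : ℕ) (s : ℝ) : ℂ :=
  ∫ v : ℝ, (a + v * Complex.I : ℂ) ^ k * Complex.exp (-s * (a + v * Complex.I)) * g v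

lemma hasDerivAt_verticalMoment {g : ℝ → ℂ} (hg : Continuous g) {b K : ℝ} (hb : 0 < b)
    (hgb : ∀ v, ‖g v‖ ≤ K * Real.exp (-b * v ^ 2)) (a : ℝ) (k : ℕ) (s : ℝ) :
    HasDerivAt (verticalMoment g a k) (-verticalMoment g a (k + 1) s) s := by
  have hK := fun k' s' => integrable_vertical_moment hg hb hgb a k' s'
  have key := (hasDerivAt_integral_of_dominated_loc_of_deriv_le (μ := volume)
    (F := fun (s : ℝ) (v : ℝ) => (a + v * Complex.I : ℂ) ^ k *
      Complex.exp (-s * (a + v * Complex.I)) * g v)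
    (F' := fun (s : ℝ) (v : ℝ) => -((a + v * Complex.I : ℂ) ^ (k + 1) *
      Complex.exp (-s * (a + v * Complex.I)) * g v))
    (bound := fun v : ℝ => Real.exp |a| * ‖(a + v * Complex.I : ℂ) ^ (k + 1) *
      Complex.exp (-s * (a + v * Complex.I)) * g v‖)
    (Metric.ball_mem_nhds s one_pos)
    (Eventually.of_forall fun s' => (hK k s').aestronglyMeasurable) (hK k s)
    (hK (k + 1) s).aestronglyMeasurable.neg
    (Eventually.of_forall fun (v : ℝ) s' hs' => ?_) ((hK (k + 1) s).norm.const_mul _)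
    (Eventually.of_forall fun (v : ℝ) s' _ => ?_)).2
  · rw [integral_neg] at key
    exact key
  · have h1 : ∀ t : ℝ, ‖Complex.exp (-t * (a + v * Complex.I))‖ = Real.exp (-t * a) := fun t => by
      rw [Complex.norm_exp]; simp
    rw [norm_neg, norm_mul, norm_mul, norm_mul, norm_mul, h1, h1]
    have h2 : Real.exp (-s' * a) ≤ Real.exp |a| * Real.exp (-s * a) := by
      rw [← Real.exp_add]
      refine Real.exp_le_exp.2 ?_
      have h3 : |s' - s| < 1 := by simpa [Real.dist_eq] using hs'
      have h4 : |(s' - s) * a| ≤ 1 * |a| := by rw [abs_mul]; gcongr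
      linarith [(abs_le.1 h4).1]
    calc _ ≤ ‖(a + v * Complex.I : ℂ) ^ (k + 1)‖ * (Real.exp |a| * Real.exp (-s * a)) * ‖g v‖ := by
          gcongr
      _ = _ := by ring
  · have h1 : HasDerivAt (fun t : ℝ => -(t : ℂ) * (a + v * Complex.I)) (-(a + v * Complex.I)) s' := by
      simpa using ((hasDerivAt_id s').ofReal_comp.neg.mul_const (a + v * Complex.I : ℂ))
    refine ((h1.cexp.const_mul ((a + v * Complex.I : ℂ) ^ k)).mul_const (g v)).congr_deriv ?_
    ring

lemma hasDerivAt_re {f : ℝ → ℂ} {f' : ℂ} {x : ℝ} (h : HasDerivAt f f' x) :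
    HasDerivAt (fun y => (f y).re) f'.re x :=
  (Complex.reCLM.hasFDerivAt.comp_hasDerivAt x h)

/-- Fourier-type representation of the Gaussian along any vertical line. -/
lemma verticalMoment_gaussian (ρ x : ℝ) :
    verticalMoment (fun v => Complex.exp ((ρ + v * Complex.I : ℂ) ^ 2)) ρ 0 (2 * x) =
      Real.sqrt π * Real.exp (-x ^ 2) := by
  have h := GaussianFourier.integral_cexp_neg_mul_sq_add_real_mul_I (b := 1) (by simp) (x - ρ)
  have h2 : ∀ v : ℝ, (ρ + v * Complex.I : ℂ) ^ 0 *
      Complex.exp (-(2 * x : ℝ) * (ρ + v * Complex.I)) * Complex.exp ((ρ + v * Complex.I : ℂ) ^ 2) =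
      Complex.exp (-x ^ 2) * Complex.exp (-1 * (v + (x - ρ : ℝ) * Complex.I) ^ 2) := fun v => by
    rw [pow_zero, one_mul, ← Complex.exp_add, ← Complex.exp_add]
    congr 1
    push_cast
    linear_combination ((v : ℂ) ^ 2 + (x - ρ) ^ 2) * Complex.I_sq
  simp_rw [verticalMoment, h2]
  rw [integral_const_mul, h, div_one]
  rw [mul_comm, Real.sqrt_eq_rpow, Complex.ofReal_cpow pi_pos.le]
  push_cast
  rfl

lemma norm_cexp_vertical_sq (ρ v : ℝ) :
    ‖Complex.exp ((ρ + v * Complex.I : ℂ) ^ 2)‖ = Real.exp (ρ ^ 2) * Real.exp (-1 * v ^ 2) := by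
  rw [Complex.norm_exp, ← Real.exp_add]
  congr 1
  simp [sq]
  ring

/-- Derivatives of the Gaussian as integrals along any vertical line. -/
lemma iteratedDeriv_gaussian (ρ : ℝ) (n : ℕ) (x : ℝ) :
    iteratedDeriv n (fun t : ℝ => Real.exp (-t ^ 2)) x = (Real.sqrt π)⁻¹ * (-2) ^ n *
      (verticalMoment (fun v => Complex.exp ((ρ + v * Complex.I : ℂ) ^ 2)) ρ n (2 * x)).re := by
  induction n generalizing x with
  | zero =>
    rw [verticalMoment_gaussian, iteratedDeriv_zero, ← Complex.ofReal_mul, Complex.ofReal_re]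
    have : Real.sqrt π ≠ 0 := by positivity
    field_simp
  | succ n ih =>
    rw [iteratedDeriv_succ, funext ih]
    have h1 := hasDerivAt_verticalMoment (g := fun v : ℝ => Complex.exp ((ρ + v * Complex.I : ℂ) ^ 2))
      (by fun_prop) one_pos (fun v => (norm_cexp_vertical_sq ρ v).le) ρ n (2 * x)
    have h2 := hasDerivAt_re (h1.scomp x ((hasDerivAt_id x).const_mul 2))
    refine (h2.const_mul ((Real.sqrt π)⁻¹ * (-2) ^ n)).deriv.trans ?_
    simp
    ring

lemma norm_verticalMoment_le (g : ℝ → ℂ) (a : ℝ) (k : ℕ) (s : ℝ) :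
    ‖verticalMoment g a k s‖ ≤
      (∫ v : ℝ, ‖(a + v * Complex.I : ℂ) ^ k * g v‖) * Real.exp (-s * a) := by
  rw [← integral_mul_const]
  refine (norm_integral_le_integral_norm _).trans (le_of_eq (integral_congr_ae ?_))
  refine Eventually.of_forall fun v => ?_
  simp only [norm_mul, Complex.norm_exp]
  have hre : (-(s : ℂ) * (a + v * Complex.I)).re = -s * a := by simp
  rw [hre]
  ring

/-- The weight `exp (z ^ 3 / 3)` on the line `Re z = 2`. -/
noncomputable def airyWeight (v : ℝ) : ℂ := Complex.exp ((((2 : ℝ) : ℂ) + v * Complex.I) ^ 3 / 3)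

lemma continuous_airyWeight : Continuous airyWeight := by
  unfold airyWeight; fun_prop

lemma norm_airyWeight (v : ℝ) :
    ‖airyWeight v‖ = Real.exp (8 / 3) * Real.exp (-2 * v ^ 2) := by
  rw [airyWeight, Complex.norm_exp, ← Real.exp_add]
  congr 1
  have : (((2 : ℝ) : ℂ) + v * Complex.I) ^ 3 / 3 =
      ((8 / 3 - 2 * v ^ 2 : ℝ) : ℂ) + ((4 * v - v ^ 3 / 3 : ℝ) : ℂ) * Complex.I := by
    push_cast
    linear_combination (2 * (v : ℂ) ^ 2 + v ^ 3 * Complex.I / 3) * Complex.I_sq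
  rw [this, Complex.add_re, Complex.ofReal_re, Complex.re_ofReal_mul, Complex.I_re]
  ring

/-- Moments of the Airy kernel along `Re z = 2`; the `k`-th one is `2 π (-1) ^ k` times a
complexified `k`-th derivative of `Ai`. -/
noncomputable def airyMoment (k : ℕ) (s : ℝ) : ℂ := verticalMoment airyWeight 2 k s

lemma integrable_airyMoment (k : ℕ) (s : ℝ) :
    Integrable (fun v : ℝ => (((2 : ℝ) : ℂ) + v * Complex.I) ^ k *
      Complex.exp (-s * (((2 : ℝ) : ℂ) + v * Complex.I)) * airyWeight v) :=
  integrable_vertical_moment continuous_airyWeight two_pos (fun v => (norm_airyWeight v).le) 2 k s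

lemma hasDerivAt_airyMoment (k : ℕ) (s : ℝ) :
    HasDerivAt (airyMoment k) (-airyMoment (k + 1) s) s :=
  hasDerivAt_verticalMoment continuous_airyWeight two_pos (fun v => (norm_airyWeight v).le) 2 k s

lemma exists_norm_airyMoment_le (k : ℕ) :
    ∃ C, 0 ≤ C ∧ ∀ s, ‖airyMoment k s‖ ≤ C * Real.exp (-s * 2) :=
  ⟨_, integral_nonneg fun _ => norm_nonneg _, norm_verticalMoment_le airyWeight 2 k⟩

/-- The differentiated Airy equation `Ai'''' = s² Ai + 2 Ai'` in terms of moments. -/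
lemma airyMoment_four (s : ℝ) :
    airyMoment 4 s = s ^ 2 * airyMoment 0 s - 2 * airyMoment 1 s := by
  have hI := fun k => integrable_airyMoment k s
  have hd : ∀ v : ℝ, HasDerivAt (fun v : ℝ => (((2 : ℝ) : ℂ) + v * Complex.I) ^ 2 *
      Complex.exp (-s * (((2 : ℝ) : ℂ) + v * Complex.I)) * airyWeight v +
      s * ((((2 : ℝ) : ℂ) + v * Complex.I) ^ 0 *
      Complex.exp (-s * (((2 : ℝ) : ℂ) + v * Complex.I)) * airyWeight v))
      (Complex.I * ((((2 : ℝ) : ℂ) + v * Complex.I) ^ 4 *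
      Complex.exp (-s * (((2 : ℝ) : ℂ) + v * Complex.I)) * airyWeight v
      - s ^ 2 * ((((2 : ℝ) : ℂ) + v * Complex.I) ^ 0 *
      Complex.exp (-s * (((2 : ℝ) : ℂ) + v * Complex.I)) * airyWeight v)
      + 2 * ((((2 : ℝ) : ℂ) + v * Complex.I) ^ 1 *
      Complex.exp (-s * (((2 : ℝ) : ℂ) + v * Complex.I)) * airyWeight v))) v := fun v => by
    have hz : HasDerivAt (fun v : ℝ => ((2 : ℝ) : ℂ) + v * Complex.I) Complex.I v := by
      simpa using ((hasDerivAt_id v).ofReal_comp.mul_const Complex.I).const_add ((2 : ℝ) : ℂ)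
    have h1 := (hz.const_mul (-(s : ℂ))).cexp
    have h2 : HasDerivAt airyWeight _ v := ((hz.pow 3).div_const 3).cexp
    refine ((((hz.pow 2).mul h1).mul h2).add
      ((((hz.pow 0).mul h1).mul h2).const_mul (s : ℂ))).congr_deriv ?_
    simp only [airyWeight, Pi.mul_apply, Pi.pow_apply]
    push_cast
    ring
  have h0 := integral_eq_zero_of_hasDerivAt_of_integrable hd
    ((((hI 4).sub ((hI 0).const_mul _)).add ((hI 1).const_mul _)).const_mul _)
    ((hI 2).add ((hI 0).const_mul _))
  have hs : Integrable (fun v : ℝ => (((2 : ℝ) : ℂ) + v * Complex.I) ^ 4 *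
      Complex.exp (-s * (((2 : ℝ) : ℂ) + v * Complex.I)) * airyWeight v
      - s ^ 2 * ((((2 : ℝ) : ℂ) + v * Complex.I) ^ 0 *
      Complex.exp (-s * (((2 : ℝ) : ℂ) + v * Complex.I)) * airyWeight v)) :=
    (hI 4).sub ((hI 0).const_mul _)
  rw [integral_const_mul, integral_add hs ((hI 1).const_mul _), integral_sub (hI 4) ((hI 0).const_mul _), integral_const_mul, integral_const_mul] at h0
  have h1 := (mul_eq_zero.1 h0).resolve_left Complex.I_ne_zero
  change airyMoment 4 s - s ^ 2 * airyMoment 0 s + 2 * airyMoment 1 s = 0 at h1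
  linear_combination h1

lemma norm_airy_kernel (s x y : ℝ) :
    ‖Complex.exp ((x + y * Complex.I : ℂ) ^ 3 / 3 - s * (x + y * Complex.I))‖ =
      Real.exp (x ^ 3 / 3 - x * y ^ 2 - s * x) := by
  rw [Complex.norm_exp]
  congr 1
  have : (x + y * Complex.I : ℂ) ^ 3 / 3 - s * (x + y * Complex.I) =
      ((x ^ 3 / 3 - x * y ^ 2 - s * x : ℝ) : ℂ) +
        ((x ^ 2 * y - y ^ 3 / 3 - s * y : ℝ) : ℂ) * Complex.I := by
    push_cast
    linear_combination (x * (y : ℂ) ^ 2 + y ^ 3 * Complex.I / 3) * Complex.I_sq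
  rw [this, Complex.add_re, Complex.ofReal_re, Complex.re_ofReal_mul, Complex.I_re]
  ring

lemma tendsto_airy_horizontal (s : ℝ) {c : ℝ → ℝ} (hc : Tendsto (fun R => c R ^ 2) atTop atTop) :
    Tendsto (fun R : ℝ => ∫ x in (0 : ℝ)..2,
      Complex.exp ((x + c R * Complex.I : ℂ) ^ 3 / 3 - s * (x + c R * Complex.I)))
      atTop (nhds 0) := by
  have h := intervalIntegral.tendsto_integral_filter_of_dominated_convergence (μ := volume)
    (a := 0) (b := 2) (l := (atTop : Filter ℝ)) (f := fun _ => (0 : ℂ))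
    (F := fun R x => Complex.exp ((x + c R * Complex.I : ℂ) ^ 3 / 3 - s * (x + c R * Complex.I)))
    (fun _ => Real.exp (8 / 3 + 2 * |s|)) (Eventually.of_forall fun R => by fun_prop)
    (Eventually.of_forall fun R => Eventually.of_forall fun x hx => ?_) (by simp)
    (Eventually.of_forall fun x hx => ?_)
  · simpa using h
  · rw [Set.uIoc_of_le (by norm_num)] at hx
    rw [norm_airy_kernel]
    refine Real.exp_le_exp.2 ?_
    have h1 : x ^ 3 ≤ 2 ^ 3 := pow_le_pow_left₀ hx.1.le hx.2 3
    have h2 : -s * x ≤ |s| * 2 := by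
      have := hx.1
      have := hx.2
      have := neg_abs_le s
      nlinarith [abs_nonneg s]
    have h3 : 0 ≤ x * c R ^ 2 := mul_nonneg hx.1.le (sq_nonneg _)
    linarith
  · rw [Set.uIoc_of_le (by norm_num)] at hx
    rw [tendsto_zero_iff_norm_tendsto_zero]
    simp_rw [norm_airy_kernel]
    refine Real.tendsto_exp_atBot.comp ?_
    have h1 : Tendsto (fun R => x * c R ^ 2) atTop atTop := hc.const_mul_atTop hx.1
    have h2 := tendsto_atBot_add_const_left atTop (x ^ 3 / 3 - s * x) (tendsto_neg_atTop_atBot.comp h1)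
    refine h2.congr fun R => ?_
    simp only [Function.comp]
    ring

lemma re_integral_airy_imaginary_axis (s R : ℝ) :
    (∫ y in (-R)..R, Complex.exp ((y * Complex.I : ℂ) ^ 3 / 3 - s * (y * Complex.I))).re =
      2 * ∫ t in (0 : ℝ)..R, Real.cos (t ^ 3 / 3 + s * t) := by
  have hcont : Continuous fun y : ℝ =>
    Complex.exp ((y * Complex.I : ℂ) ^ 3 / 3 - s * (y * Complex.I)) := by fun_prop
  have h1 := Complex.reCLM.intervalIntegral_comp_comm (hcont.intervalIntegrable (μ := volume) (-R) R)
  have h2 : ∀ y : ℝ, Complex.reCLM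
      (Complex.exp ((y * Complex.I : ℂ) ^ 3 / 3 - s * (y * Complex.I))) =
      Real.cos (y ^ 3 / 3 + s * y) := fun y => by
    have : (y * Complex.I : ℂ) ^ 3 / 3 - s * (y * Complex.I) =
        ((-(y ^ 3 / 3 + s * y) : ℝ) : ℂ) * Complex.I := by
      push_cast
      linear_combination ((y : ℂ) ^ 3 * Complex.I / 3) * Complex.I_sq
    rw [this, Complex.reCLM_apply, Complex.exp_ofReal_mul_I_re, Real.cos_neg]
  simp_rw [h2] at h1
  rw [Complex.reCLM_apply] at h1
  rw [← h1]
  have hc : Continuous fun y : ℝ => Real.cos (y ^ 3 / 3 + s * y) := by fun_prop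
  rw [← intervalIntegral.integral_add_adjacent_intervals (hc.intervalIntegrable (-R) 0)
    (hc.intervalIntegrable 0 R)]
  have h3 := intervalIntegral.integral_comp_neg (a := 0) (b := R)
    (fun y : ℝ => Real.cos (y ^ 3 / 3 + s * y))
  rw [neg_zero] at h3
  rw [← h3, two_mul]
  congr 1
  refine intervalIntegral.integral_congr fun y _ => ?_
  rw [← Real.cos_neg]
  congr 1
  ring

lemma Ai_eq_airyMoment (s : ℝ) : Ai s = (2 * π)⁻¹ * (airyMoment 0 s).re := by
  set f : ℂ → ℂ := fun z => Complex.exp (z ^ 3 / 3 - s * z) with hf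
  have hrect : ∀ R : ℝ, ∫ y in (-R)..R, f (y * Complex.I) =
      (∫ y in (-R)..R, f (((2 : ℝ) : ℂ) + y * Complex.I)) - Complex.I *
      ((∫ x in (0 : ℝ)..2, f (x + (-R : ℝ) * Complex.I)) - ∫ x in (0 : ℝ)..2, f (x + R * Complex.I)) := by
    intro R
    have h := Complex.integral_boundary_rect_eq_zero_of_differentiableOn f (-R * Complex.I)
      (2 + R * Complex.I) (by rw [hf]; fun_prop)
    simp [-neg_mul, -mul_neg] at h
    push_cast
    linear_combination Complex.I * h + ((∫ y in (-R)..R, f (y * Complex.I)) -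
      ∫ y in (-R)..R, f (2 + y * Complex.I)) * Complex.I_sq
  have hI : Integrable (fun y : ℝ => f (((2 : ℝ) : ℂ) + y * Complex.I)) := by
    refine (integrable_airyMoment 0 s).congr (Eventually.of_forall fun v => ?_)
    simp only [hf, airyWeight, pow_zero, one_mul, ← Complex.exp_add]
    congr 1
    ring
  have hval : ∫ y : ℝ, f (((2 : ℝ) : ℂ) + y * Complex.I) = airyMoment 0 s := by
    refine integral_congr_ae (Eventually.of_forall fun v => ?_)
    simp only [hf, airyWeight, pow_zero, one_mul, ← Complex.exp_add]
    congr 1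
    ring
  have hlim : Tendsto (fun R : ℝ => ∫ y in (-R)..R, f (y * Complex.I)) atTop
      (nhds (airyMoment 0 s)) := by
    simp_rw [hrect]
    have h1 := intervalIntegral_tendsto_integral hI tendsto_neg_atTop_atBot tendsto_id
    have h2 := tendsto_airy_horizontal s (c := fun R => -R) (by
      simp [tendsto_pow_atTop (α := ℝ) two_ne_zero])
    have h3 := tendsto_airy_horizontal s (c := fun R => R) (tendsto_pow_atTop two_ne_zero)
    have h4 := h1.sub ((h2.sub h3).const_mul Complex.I)
    rw [hval] at h4
    simpa using h4
  have h5 : Tendsto (fun R : ℝ => ∫ t in (0 : ℝ)..R, Real.cos (t ^ 3 / 3 + s * t)) atTop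
      (nhds ((airyMoment 0 s).re / 2)) := by
    have h6 := ((Complex.continuous_re.tendsto _).comp hlim).div_const 2
    refine h6.congr fun R => ?_
    have := re_integral_airy_imaginary_axis s R
    simp only [Function.comp, hf]
    rw [this]
    ring
  rw [Ai, h5.limUnder_eq]
  field_simp

lemma hasDerivAt_Ai (s : ℝ) : HasDerivAt Ai (-((2 * π)⁻¹ * (airyMoment 1 s).re)) s := by
  rw [funext Ai_eq_airyMoment]
  refine ((hasDerivAt_re (hasDerivAt_airyMoment 0 s)).const_mul _).congr_deriv ?_
  simp

/-- The rescaled integrand `exp (ε⁻³ (log (1 + εz) - εz + ε²z²/2) - log (1 + εz) - σz + εσ²/4)`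
of the contour integral for the oscillator function with `N = ε⁻³`. -/
noncomputable def edgeKernel (ε σ : ℝ) (z : ℂ) : ℂ :=
  Complex.exp (((ε ^ 3)⁻¹ : ℝ) * (Complex.log (1 + ε * z) - ε * z + (ε * z) ^ 2 / 2)
    - Complex.log (1 + ε * z) - σ * z + (ε * σ ^ 2 / 4 : ℝ))

/-- The natural small parameter `N^{-1/3}` at the soft edge. -/
noncomputable def epsN (N : ℕ) : ℝ := (N : ℝ) ^ (-(1 : ℝ) / 3)

/-- Normalization of the contour integral, converging to `1` by Stirling's formula. -/
noncomputable def kappaN (N : ℕ) : ℝ := Real.sqrt (Real.sqrt π / Stirling.stirlingSeq N)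

lemma epsN_pos {N : ℕ} (hN : N ≠ 0) : 0 < epsN N := by
  have : (0 : ℝ) < N := by positivity
  exact Real.rpow_pos_of_pos this _

lemma epsN_pow_three {N : ℕ} : epsN N ^ 3 = (N : ℝ)⁻¹ := by
  rw [epsN, ← Real.rpow_natCast, ← Real.rpow_mul (by positivity)]
  norm_num [Real.rpow_neg_one]

lemma epsN_sq {N : ℕ} : epsN N ^ 2 = (N : ℝ) ^ (-(2 : ℝ) / 3) := by
  rw [epsN, ← Real.rpow_natCast, ← Real.rpow_mul (by positivity)]
  norm_num

lemma tauN_pos {N : ℕ} (hN : N ≠ 0) : 0 < tauN N := by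
  have : (0 : ℝ) < N := by positivity
  unfold tauN
  positivity

lemma tauN_sq {N : ℕ} : tauN N ^ 2 = epsN N / 2 := by
  rw [tauN, epsN, mul_pow, ← Real.rpow_natCast, ← Real.rpow_natCast, ← Real.rpow_mul (by positivity),
    ← Real.rpow_mul (by positivity)]
  norm_num [Real.rpow_neg_one]
  ring

lemma sqrt_mul_tauN_mul_epsN {N : ℕ} (hN : N ≠ 0) :
    Real.sqrt (N / 2) * tauN N * epsN N = 1 / 2 := by
  have hε := epsN_pos hN
  have hτ := tauN_pos hN
  have hN0 : (0 : ℝ) < N := by positivity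
  rw [← sq_eq_sq₀ (by positivity) (by positivity), mul_pow, mul_pow, tauN_sq,
    Real.sq_sqrt (by positivity)]
  have h := epsN_pow_three (N := N)
  have h2 : epsN N ^ 3 * N = 1 := by rw [h]; field_simp
  linear_combination h2 / 4

lemma hermite_integrand_eq {r ε τ σ : ℝ} {n : ℕ} (hr : ((n + 1 : ℕ) : ℝ) = 2 * r ^ 2)
    (hε : ((n + 1 : ℕ) : ℝ) = (ε ^ 3)⁻¹) (hrte : r * τ * ε = 1 / 2) (hτ : τ ^ 2 = ε / 2) {z : ℂ}
    (hz : 1 + ε * z ≠ 0) :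
    (r * (1 + ε * z)) ^ n * Complex.exp (-((2 * (2 * r + τ * σ) : ℝ) : ℂ) * (r * (1 + ε * z))) *
      Complex.exp ((r * (1 + ε * z)) ^ 2) =
    ((Real.exp (-(2 * r + τ * σ) ^ 2 / 2) * (r ^ n * Real.exp (-((n + 1 : ℕ) : ℝ) / 2)) : ℝ) : ℂ) *
      edgeKernel ε σ z := by
  have h1 : (1 + ε * z) ^ n = Complex.exp (n * Complex.log (1 + ε * z)) := by
    rw [Complex.exp_nat_mul, Complex.exp_log hz]
  have h2 : (r : ℂ) * τ * ε = 1 / 2 := by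
    have := congrArg (fun t : ℝ => (t : ℂ)) hrte
    push_cast at this
    exact this
  have h3 : (τ : ℂ) ^ 2 = ε / 2 := by
    have := congrArg (fun t : ℝ => (t : ℂ)) hτ
    push_cast at this
    exact this
  have h4 : (n : ℂ) + 1 = 2 * r ^ 2 := by
    have := congrArg (fun t : ℝ => (t : ℂ)) hr
    push_cast at this
    exact this
  rw [mul_pow, h1, edgeKernel, ← hε]
  push_cast
  have h5 : ∀ A B C D E : ℂ, A + B + C = D + E →
      (r : ℂ) ^ n * Complex.exp A * Complex.exp B * Complex.exp C =
      (r : ℂ) ^ n * Complex.exp D * Complex.exp E := fun A B C D E h => by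
    rw [mul_assoc, mul_assoc, mul_assoc, ← Complex.exp_add, ← Complex.exp_add, ← Complex.exp_add,
      ← h, add_assoc]
  rw [show ∀ A B C : ℂ, A * ((r : ℂ) ^ n * B) * C = r ^ n * (A * B) * C from fun _ _ _ => by ring,
    ← Complex.exp_add]
  refine h5 _ _ _ _ _ ?_
  linear_combination (-(σ : ℂ) * z * 2) * h2 + (σ : ℂ) ^ 2 / 2 * h3 +
    (ε * z - (ε * z) ^ 2 / 2 + 1 / 2) * h4

lemma edge_constant {n : ℕ} {r ε τ : ℝ} (hr0 : 0 < r) (hε0 : 0 < ε) (hτ0 : 0 < τ)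
    (hr : ((n + 1 : ℕ) : ℝ) = 2 * r ^ 2)
    (hε : ((n + 1 : ℕ) : ℝ) = (ε ^ 3)⁻¹) (hτ : τ ^ 2 = ε / 2) :
    (2 * ((n + 1 : ℕ) : ℝ)) ^ ((1 : ℝ) / 4) * τ * hNorm n ^ (-(1 : ℝ) / 2) * (Real.sqrt π)⁻¹ *
      2 ^ n * (r * ε) * (r ^ n * Real.exp (-((n + 1 : ℕ) : ℝ) / 2)) = kappaN (n + 1) * (2 * π)⁻¹ := by
  have hst := Stirling.stirlingSeq'_pos n
  have hh : 0 < hNorm n := by unfold hNorm; positivity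
  rw [← sq_eq_sq₀ (by positivity) (by unfold kappaN; positivity)]
  simp only [mul_pow, kappaN]
  rw [Real.sq_sqrt (by positivity)]
  have e1 : ((2 * ((n + 1 : ℕ) : ℝ)) ^ ((1 : ℝ) / 4)) ^ 2 = Real.sqrt (2 * ((n + 1 : ℕ) : ℝ)) := by
    rw [← Real.rpow_natCast, ← Real.rpow_mul (by positivity), Real.sqrt_eq_rpow]
    norm_num
  have e2 : (hNorm n ^ (-(1 : ℝ) / 2)) ^ 2 = (hNorm n)⁻¹ := by
    rw [← Real.rpow_natCast, ← Real.rpow_mul hh.le]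
    norm_num [Real.rpow_neg_one]
  have e3 : Real.exp (-((n + 1 : ℕ) : ℝ) / 2) ^ 2 = (Real.exp 1 ^ (n + 1))⁻¹ := by
    rw [← Real.exp_nat_mul, ← Real.exp_nat_mul, ← Real.exp_neg]
    congr 1
    push_cast
    ring
  have e4 : ((r ^ n) ^ 2 * r ^ 2) * 2 ^ (n + 1) = ((n + 1 : ℕ) : ℝ) ^ (n + 1) := by
    rw [hr, mul_pow, ← pow_mul, ← pow_mul, ← pow_add]
    ring
  have e5 : (Real.sqrt (2 * ((n + 1 : ℕ) : ℝ))) ^ 2 = 2 * ((n + 1 : ℕ) : ℝ) :=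
    Real.sq_sqrt (by positivity)
  have e6 : Real.sqrt π ^ 2 = π := Real.sq_sqrt pi_pos.le
  have e7 : ε ^ 3 * ((n + 1 : ℕ) : ℝ) = 1 := by rw [hε]; field_simp
  rw [e1, e2, e3, hτ, Stirling.stirlingSeq, Nat.factorial_succ, hNorm, div_pow, ← e4]
  push_cast at e5 e7 ⊢
  set q := Real.sqrt (2 * ((n : ℝ) + 1)) with hq
  set p := Real.sqrt π with hp
  have hq0 : 0 < q := by positivity
  have hp0 : 0 < p := by positivity
  have hfac : (0 : ℝ) < n.factorial := by positivity
  rw [← e6]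
  field_simp
  linear_combination (2 * 2 ^ n) * e7

lemma psiTauR_eq {N : ℕ} (hN : N ≠ 0) {a s δ : ℝ} (ha : 0 < 1 + epsN N * a)
    (hδ : Real.sqrt (2 * N + 1) = Real.sqrt (2 * N) + tauN N * δ) :
    psiTauR N s = kappaN N * (2 * π)⁻¹ *
      (∫ v : ℝ, edgeKernel (epsN N) (s + δ) (a + v * Complex.I)).re := by
  obtain ⟨n, rfl⟩ := Nat.exists_eq_succ_of_ne_zero hN
  have hε0 := epsN_pos hN
  have hτ0 := tauN_pos hN
  have hrte := sqrt_mul_tauN_mul_epsN hN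
  have hτ := tauN_sq (N := n + 1)
  have hε : ((n + 1 : ℕ) : ℝ) = (epsN (n + 1) ^ 3)⁻¹ := by rw [epsN_pow_three, inv_inv]
  have hr : ((n + 1 : ℕ) : ℝ) = 2 * Real.sqrt (((n + 1 : ℕ) : ℝ) / 2) ^ 2 := by
    rw [Real.sq_sqrt (by positivity)]; ring
  have hr0 : 0 < Real.sqrt (((n + 1 : ℕ) : ℝ) / 2) := by positivity
  have h2r : Real.sqrt (2 * ((n + 1 : ℕ) : ℝ)) = 2 * Real.sqrt (((n + 1 : ℕ) : ℝ) / 2) := by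
    rw [Real.sqrt_eq_iff_mul_self_eq (by positivity) (by positivity)]
    linear_combination (2 : ℝ) * hr
  have hx : Real.sqrt (2 * ((n + 1 : ℕ) : ℝ) + 1) + tauN (n + 1) * s =
      2 * Real.sqrt (((n + 1 : ℕ) : ℝ) / 2) + tauN (n + 1) * (s + δ) := by
    rw [hδ, h2r]; ring
  rw [psiTauR, Nat.succ_eq_add_one, Nat.add_sub_cancel, hx, ← edge_constant hr0 hε0 hτ0 hr hε hτ]
  generalize Real.sqrt (((n + 1 : ℕ) : ℝ) / 2) = r at *
  generalize epsN (n + 1) = ε at *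
  generalize tauN (n + 1) = τ at *
  generalize s + δ = σ
  rw [osc, physHermite, iteratedDeriv_gaussian (r * (1 + ε * a))]
  have hint : verticalMoment (fun v => Complex.exp ((((r * (1 + ε * a) : ℝ) : ℂ) + v * Complex.I) ^ 2))
      (r * (1 + ε * a)) n (2 * (2 * r + τ * σ)) = ((r * ε : ℝ) : ℂ) *
      (((Real.exp (-(2 * r + τ * σ) ^ 2 / 2) *
        (r ^ n * Real.exp (-((n + 1 : ℕ) : ℝ) / 2)) : ℝ) : ℂ) *
      ∫ v : ℝ, edgeKernel ε σ (a + v * Complex.I)) := by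
    have h := Measure.integral_comp_mul_left (fun y : ℝ =>
      (((r * (1 + ε * a) : ℝ) : ℂ) + y * Complex.I) ^ n *
      Complex.exp (-((2 * (2 * r + τ * σ) : ℝ) : ℂ) * (((r * (1 + ε * a) : ℝ) : ℂ) + y * Complex.I)) *
      Complex.exp ((((r * (1 + ε * a) : ℝ) : ℂ) + y * Complex.I) ^ 2)) (r * ε)
    rw [abs_of_pos (by positivity), Complex.real_smul] at h
    rw [← integral_const_mul, verticalMoment]
    have h2 : ((r * ε : ℝ) : ℂ) ≠ 0 := by
      exact_mod_cast (mul_pos hr0 hε0).ne'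
    rw [Complex.ofReal_inv, eq_inv_mul_iff_mul_eq₀ h2] at h
    rw [← h]
    congr 1
    refine integral_congr_ae (Eventually.of_forall fun v => ?_)
    have hz : (1 : ℂ) + ε * (a + v * Complex.I) ≠ 0 := fun h0 => by
      have := congrArg Complex.re h0
      simp at this
      linarith
    have h3 := hermite_integrand_eq (σ := σ) hr hε hrte hτ hz
    beta_reduce
    rw [← h3]
    have h4 : (((r * (1 + ε * a) : ℝ) : ℂ) + ((r * ε * v : ℝ) : ℂ) * Complex.I) =
      r * (1 + ε * (a + v * Complex.I)) := by push_cast; ring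
    simp only [h4]
  rw [hint, Complex.re_ofReal_mul, Complex.re_ofReal_mul]
  generalize (∫ v : ℝ, edgeKernel ε σ (a + v * Complex.I)).re = Q
  have e1 : Real.exp (-(2 * r + τ * σ) ^ 2 / 2) * Real.exp ((2 * r + τ * σ) ^ 2) *
      Real.exp (-(2 * r + τ * σ) ^ 2 / 2) = 1 := by
    rw [← Real.exp_add, ← Real.exp_add, Real.exp_eq_one_iff]; ring
  have e2 : (-1 : ℝ) ^ n * (-2) ^ n = 2 ^ n := by rw [← mul_pow]; norm_num
  rw [← e2]
  linear_combination ((2 * ((n + 1 : ℕ) : ℝ)) ^ ((1 : ℝ) / 4) * τ * hNorm n ^ (-(1 : ℝ) / 2) *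
    (Real.sqrt π)⁻¹ * ((-1) ^ n * (-2) ^ n) * (r * ε) *
    (r ^ n * Real.exp (-((n + 1 : ℕ) : ℝ) / 2)) * Q) * e1

lemma log_stirlingSeq_le (n : ℕ) :
    Real.log (Stirling.stirlingSeq (n + 1)) ≤ Real.log (Real.sqrt π) + 1 / (12 * ((n : ℝ) + 1)) := by
  have hmono : Monotone (fun k : ℕ => Real.log (Stirling.stirlingSeq (k + 1)) -
      1 / (12 * ((k : ℝ) + 1))) := by
    refine monotone_nat_of_le_succ fun k => ?_
    have h := Stirling.log_stirlingSeq_sdiff_le (k + 1)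
    have h2 : 1 / (12 * ((k : ℝ) + 1)) - 1 / (12 * ((k : ℝ) + 1 + 1)) =
        1 / (12 * ((k : ℝ) + 1) * ((k : ℝ) + 1 + 1)) := by field_simp; ring
    push_cast at h ⊢
    linarith
  have hlim : Tendsto (fun k : ℕ => Real.log (Stirling.stirlingSeq (k + 1)) -
      1 / (12 * ((k : ℝ) + 1))) atTop (nhds (Real.log (Real.sqrt π) - 0)) := by
    refine Tendsto.sub ?_ ?_
    · exact ((Real.continuousAt_log (by positivity)).tendsto).comp
        (Stirling.tendsto_stirlingSeq_sqrt_pi.comp (tendsto_add_atTop_nat 1))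
    · have h := (tendsto_one_div_add_atTop_nhds_zero_nat (𝕜 := ℝ)).const_mul (1 / 12)
      rw [mul_zero] at h
      refine h.congr fun k => ?_
      field_simp
  have := hmono.ge_of_tendsto hlim n
  simp only [sub_zero] at this
  linarith

lemma kappaN_nonneg (N : ℕ) : 0 ≤ kappaN N := Real.sqrt_nonneg _

lemma kappaN_le_one {N : ℕ} (hN : N ≠ 0) : kappaN N ≤ 1 := by
  obtain ⟨n, rfl⟩ := Nat.exists_eq_succ_of_ne_zero hN
  exact Real.sqrt_le_one.2 <| (div_le_one (Stirling.stirlingSeq'_pos n)).2 (Stirling.sqrt_pi_le_stirlingSeq hN)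

lemma one_sub_kappaN_le {N : ℕ} (hN : N ≠ 0) : 1 - kappaN N ≤ (N : ℝ)⁻¹ := by
  obtain ⟨n, rfl⟩ := Nat.exists_eq_succ_of_ne_zero hN
  have hp := Stirling.stirlingSeq'_pos n
  have h0 := kappaN_nonneg (n + 1)
  have h1 := kappaN_le_one hN
  have hsq : kappaN (n + 1) ^ 2 = Real.sqrt π / Stirling.stirlingSeq (n + 1) :=
    Real.sq_sqrt (by positivity)
  have hlog : Real.log (Real.sqrt π / Stirling.stirlingSeq (n + 1)) ≥ -(1 / (12 * ((n : ℝ) + 1))) := by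
    rw [Real.log_div (by positivity) hp.ne']
    have := log_stirlingSeq_le n
    linarith
  have h2 : 1 - 1 / (12 * ((n : ℝ) + 1)) ≤ kappaN (n + 1) ^ 2 := by
    rw [hsq]
    have := Real.log_le_sub_one_of_pos
      (show 0 < Real.sqrt π / Stirling.stirlingSeq (n + 1) by positivity)
    linarith
  have h3 : 1 / (12 * ((n : ℝ) + 1)) ≤ ((n + 1 : ℕ) : ℝ)⁻¹ := by
    push_cast
    rw [← one_div]
    gcongr
    linarith [(by positivity : (0 : ℝ) ≤ n)]
  simp only [Nat.succ_eq_add_one] at *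
  nlinarith

/-- The displacement `(√(2N+1) - √(2N)) / τ_N`. -/
noncomputable def shiftN (N : ℕ) : ℝ := (Real.sqrt (2 * N + 1) - Real.sqrt (2 * N)) / tauN N

lemma sqrt_eq_add_tauN_mul_shiftN {N : ℕ} (hN : N ≠ 0) :
    Real.sqrt (2 * N + 1) = Real.sqrt (2 * N) + tauN N * shiftN N := by
  have := (tauN_pos hN).ne'
  rw [shiftN]
  field_simp
  ring

lemma sqrt_mul_tauN {N : ℕ} (hN : N ≠ 0) : Real.sqrt (2 * N) * tauN N * epsN N = 1 := by
  have h2r : Real.sqrt (2 * (N : ℝ)) = 2 * Real.sqrt ((N : ℝ) / 2) := by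
    rw [Real.sqrt_eq_iff_mul_self_eq (by positivity) (by positivity)]
    linear_combination -4 * Real.mul_self_sqrt (show (0 : ℝ) ≤ (N : ℝ) / 2 by positivity)
  rw [h2r]
  linear_combination 2 * sqrt_mul_tauN_mul_epsN hN

lemma shiftN_bounds {N : ℕ} (hN : N ≠ 0) :
    0 ≤ shiftN N ∧ shiftN N ≤ epsN N ∧ |shiftN N - epsN N / 2| ≤ epsN N ^ 4 := by
  have hε := epsN_pos hN
  have hτ := tauN_pos hN
  have h0 : 0 ≤ shiftN N := by
    refine div_nonneg (sub_nonneg.2 (Real.sqrt_le_sqrt (by linarith))) hτ.le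
  have h1 := congrArg (· ^ 2) (sqrt_eq_add_tauN_mul_shiftN hN)
  rw [Real.sq_sqrt (by positivity), add_sq, mul_pow, Real.sq_sqrt (by positivity), tauN_sq] at h1
  have h2 := sqrt_mul_tauN hN
  have h3 : epsN N = 2 * shiftN N + epsN N ^ 2 * shiftN N ^ 2 / 2 := by
    linear_combination epsN N * h1 + 2 * shiftN N * h2
  have h4 : 0 ≤ epsN N ^ 2 * shiftN N ^ 2 := by positivity
  have h5 : shiftN N ≤ epsN N := by linarith
  have h6 : epsN N ^ 2 * shiftN N ^ 2 ≤ epsN N ^ 2 * epsN N ^ 2 := by gcongr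
  refine ⟨h0, h5, abs_le.2 ⟨?_, ?_⟩⟩
  · nlinarith
  · nlinarith

lemma abs_DeltaN_sub_le {N : ℕ} (hN : N ≠ 0) : |DeltaN N - epsN N| ≤ 2 * epsN N ^ 4 := by
  have hε := epsN_pos hN
  have hτ := tauN_pos hN
  have hN1 : (1 : ℝ) ≤ N := by exact_mod_cast Nat.one_le_iff_ne_zero.2 hN
  set η := (Real.sqrt (2 * N) - Real.sqrt (2 * N - 1)) / tauN N with hη
  have hΔ : DeltaN N = shiftN N + η := by rw [DeltaN, shiftN, hη]; ring
  have h0 : 0 ≤ η := div_nonneg (sub_nonneg.2 (Real.sqrt_le_sqrt (by linarith))) hτ.le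
  have h1 : Real.sqrt (2 * N - 1) = Real.sqrt (2 * N) - tauN N * η := by
    rw [hη]; field_simp; ring
  have hs := Real.sqrt_nonneg (2 * (N : ℝ) - 1)
  have h2 := congrArg (· ^ 2) h1
  rw [Real.sq_sqrt (by linarith), sub_sq, mul_pow, Real.sq_sqrt (by positivity), tauN_sq] at h2
  have h3 := sqrt_mul_tauN hN
  have h4 : epsN N = 2 * η - epsN N ^ 2 * η ^ 2 / 2 := by
    linear_combination -epsN N * h2 + 2 * η * h3
  have h5 : epsN N ^ 2 * η ≤ 2 := by
    have h6 : epsN N * (tauN N * η) ≤ epsN N * Real.sqrt (2 * N) := by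
      gcongr
      linarith
    have h7 : epsN N * (tauN N * η) * tauN N ≤ epsN N * Real.sqrt (2 * N) * tauN N := by gcongr
    have h8 : epsN N * (tauN N * η) * tauN N = epsN N ^ 2 * η / 2 := by
      linear_combination epsN N * η * (tauN_sq (N := N))
    linarith
  have h9 : η ≤ epsN N := by nlinarith
  have h10 : epsN N ^ 2 * η ^ 2 ≤ epsN N ^ 2 * epsN N ^ 2 := by gcongr
  obtain ⟨_, _, h11⟩ := shiftN_bounds hN
  rw [hΔ]
  rw [abs_le] at h11 ⊢
  have : 0 ≤ epsN N ^ 2 * η ^ 2 := by positivity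
  constructor <;> nlinarith

lemma one_le_norm_one_add {w : ℂ} (hw : 0 ≤ w.re) : 1 ≤ ‖1 + w‖ := by
  refine le_trans ?_ (Complex.re_le_norm (1 + w))
  simpa using hw

lemma one_add_mem_slitPlane {w : ℂ} (hw : 0 ≤ w.re) : 1 + w ∈ Complex.slitPlane :=
  Or.inl (by simp; linarith)

/-- Fourth-order Taylor bound for `log (1 + w)` on the closed right half-plane. -/
lemma norm_log_one_add_sub_le {w : ℂ} (hw : 0 ≤ w.re) :
    ‖Complex.log (1 + w) - w + w ^ 2 / 2 - w ^ 3 / 3 + w ^ 4 / 4‖ ≤ ‖w‖ ^ 5 := by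
  have hre : ∀ t : ℝ, 0 ≤ t → 0 ≤ ((t : ℂ) * w).re := fun t ht => by
    rw [Complex.re_ofReal_mul]; positivity
  have hd : ∀ t ∈ Set.Icc (0 : ℝ) 1, HasDerivWithinAt (fun t : ℝ => Complex.log (1 + t * w) - t * w +
      (t * w) ^ 2 / 2 - (t * w) ^ 3 / 3 + (t * w) ^ 4 / 4)
      (w * (t * w) ^ 4 / (1 + t * w)) (Set.Icc 0 1) t := fun t ht => by
    have hne : (1 + t * w : ℂ) ≠ 0 := norm_pos_iff.1 (one_pos.trans_le (one_le_norm_one_add (hre t ht.1)))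
    have h1 : HasDerivAt (fun t : ℝ => (t : ℂ) * w) w t := by
      simpa using (hasDerivAt_id t).ofReal_comp.mul_const w
    have h2 := (h1.const_add 1).clog_real (one_add_mem_slitPlane (hre t ht.1))
    refine (((((h2.sub h1).add ((h1.pow 2).div_const 2)).sub ((h1.pow 3).div_const 3)).add
      ((h1.pow 4).div_const 4)).congr_deriv ?_).hasDerivWithinAt
    have hq : w / (1 + t * w) * (1 + t * w) = w := div_mul_cancel₀ w hne
    rw [mul_div_right_comm w]
    generalize w / (1 + t * w) = q at hq ⊢
    push_cast
    linear_combination (1 - t * w + (t * w) ^ 2 - (t * w) ^ 3) * hq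
  have := norm_image_sub_le_of_norm_deriv_le_segment_01' hd (C := ‖w‖ ^ 5) fun t ht => by
    rw [norm_div, norm_mul, norm_pow, norm_mul, Complex.norm_real, Real.norm_of_nonneg ht.1]
    have ht0 := ht.1
    refine (div_le_self (by positivity) (one_le_norm_one_add (hre t ht.1))).trans ?_
    calc _ ≤ ‖w‖ * (1 * ‖w‖) ^ 4 := by gcongr; exact ht.2.le
      _ = _ := by ring
  simpa using this

/-- First-order Taylor bound for `log (1 + w)` on the closed right half-plane. -/
lemma norm_log_one_add_sub_self_le {w : ℂ} (hw : 0 ≤ w.re) :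
    ‖Complex.log (1 + w) - w‖ ≤ ‖w‖ ^ 2 := by
  have hre : ∀ t : ℝ, 0 ≤ t → 0 ≤ ((t : ℂ) * w).re := fun t ht => by
    rw [Complex.re_ofReal_mul]; positivity
  have hd : ∀ t ∈ Set.Icc (0 : ℝ) 1, HasDerivWithinAt (fun t : ℝ => Complex.log (1 + t * w) - t * w)
      (-w * (t * w) / (1 + t * w)) (Set.Icc 0 1) t := fun t ht => by
    have hne : (1 + t * w : ℂ) ≠ 0 := norm_pos_iff.1 (one_pos.trans_le (one_le_norm_one_add (hre t ht.1)))
    have h1 : HasDerivAt (fun t : ℝ => (t : ℂ) * w) w t := by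
      simpa using (hasDerivAt_id t).ofReal_comp.mul_const w
    have h2 := (h1.const_add 1).clog_real (one_add_mem_slitPlane (hre t ht.1))
    refine ((h2.sub h1).congr_deriv ?_).hasDerivWithinAt
    have hq : w / (1 + t * w) * (1 + t * w) = w := div_mul_cancel₀ w hne
    rw [neg_mul, neg_div, mul_div_right_comm]
    generalize w / (1 + t * w) = q at hq ⊢
    linear_combination hq
  have := norm_image_sub_le_of_norm_deriv_le_segment_01' hd (C := ‖w‖ ^ 2) fun t ht => by
    rw [norm_div, norm_mul, norm_neg, norm_mul, Complex.norm_real, Real.norm_of_nonneg ht.1]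
    have ht0 := ht.1
    refine (div_le_self (by positivity) (one_le_norm_one_add (hre t ht.1))).trans ?_
    calc _ ≤ ‖w‖ * (1 * ‖w‖) := by gcongr; exact ht.2.le
      _ = _ := by ring
  simpa using this

lemma log_one_add_le_taylor {x : ℝ} (hx : 0 ≤ x) :
    Real.log (1 + x) ≤ x - x ^ 2 / 2 + x ^ 3 / 3 + x ^ 5 := by
  have h := norm_log_one_add_sub_le (w := x) (by simpa using hx)
  have h2 : Complex.log (1 + x) - x + (x : ℂ) ^ 2 / 2 - (x : ℂ) ^ 3 / 3 + (x : ℂ) ^ 4 / 4 =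
      ((Real.log (1 + x) - x + x ^ 2 / 2 - x ^ 3 / 3 + x ^ 4 / 4 : ℝ) : ℂ) := by
    push_cast
    rw [Complex.ofReal_log (by linarith)]
    push_cast
    rfl
  rw [h2, Complex.norm_real, Complex.norm_real, Real.norm_of_nonneg hx] at h
  have h3 := (le_abs_self _).trans h
  have : 0 ≤ x ^ 4 := by positivity
  linarith

/-- Remainder bound for the exponential with a two-sided majorant. -/
lemma norm_exp_sub_one_sub_le (A : ℂ) :
    ‖Complex.exp A - 1 - A‖ ≤ ‖A‖ ^ 2 * (2 + ‖Complex.exp A‖) := by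
  rcases le_total ‖A‖ 1 with h | h
  · refine (Complex.norm_exp_sub_one_sub_id_le h).trans ?_
    have := norm_nonneg (Complex.exp A)
    nlinarith [sq_nonneg ‖A‖]
  · have h1 : ‖Complex.exp A - 1 - A‖ ≤ ‖Complex.exp A‖ + 1 + ‖A‖ := by
      refine (norm_sub_le _ _).trans ?_
      gcongr
      simpa using norm_sub_le (Complex.exp A) 1
    have h2 := norm_nonneg (Complex.exp A)
    have h3 : 1 ≤ ‖A‖ ^ 2 := one_le_pow₀ h
    nlinarith [mul_le_mul_of_nonneg_right h3 h2]

lemma norm_edgeKernel_le {ε a : ℝ} (hε : 0 < ε) (hε' : ε ≤ 1 / 4) (ha : 0 ≤ a) (σ v : ℝ) :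
    ‖edgeKernel ε σ (a + v * Complex.I)‖ ≤ Real.exp (5 - v ^ 2 +
      (4 * (a - 2) / (1 + 2 * ε) + (a - 2) ^ 2 / ε) - σ * a + ε * σ ^ 2 / 4) := by
  set w : ℂ := ε * (a + v * Complex.I) with hw
  have hwre : w.re = ε * a := by simp [hw]
  have hwim : w.im = ε * v := by simp [hw]
  have hw0 : 0 ≤ w.re := by rw [hwre]; positivity
  have h1 := one_le_norm_one_add hw0
  have hlog0 : 0 ≤ Real.log ‖1 + w‖ := Real.log_nonneg h1
  have ht : 0 < 1 + 2 * ε := by positivity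
  have hsq : ‖1 + w‖ ^ 2 = (1 + ε * a) ^ 2 + (ε * v) ^ 2 := by
    rw [← Complex.normSq_eq_norm_sq, Complex.normSq_apply]
    simp [hwre, hwim]
    ring
  have hlog : Real.log ‖1 + w‖ ≤ Real.log (1 + 2 * ε) +
      (((1 + ε * a) ^ 2 + (ε * v) ^ 2) / (1 + 2 * ε) ^ 2 - 1) / 2 := by
    have h2 := Real.log_le_sub_one_of_pos (show 0 < ‖1 + w‖ ^ 2 / (1 + 2 * ε) ^ 2 by positivity)
    rw [Real.log_div (by positivity) (by positivity), Real.log_pow, Real.log_pow, hsq] at h2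
    push_cast at h2
    linarith
  have hlog2 := log_one_add_le_taylor (show 0 ≤ 2 * ε by positivity)
  have hre : (((ε ^ 3)⁻¹ : ℝ) * (Complex.log (1 + w) - w + w ^ 2 / 2)
    - Complex.log (1 + w) - σ * (a + v * Complex.I) + (ε * σ ^ 2 / 4 : ℝ) : ℂ).re =
      (ε ^ 3)⁻¹ * (Real.log ‖1 + w‖ - ε * a + ((ε * a) ^ 2 - (ε * v) ^ 2) / 2) - Real.log ‖1 + w‖
      - σ * a + ε * σ ^ 2 / 4 := by
    have h3 : (w ^ 2 / 2).re = ((ε * a) ^ 2 - (ε * v) ^ 2) / 2 := by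
      have : w ^ 2 / 2 = ((1 / 2 : ℝ) : ℂ) * (w * w) := by push_cast; ring
      rw [this, Complex.re_ofReal_mul, Complex.mul_re, hwre, hwim]
      ring
    rw [Complex.add_re, Complex.sub_re, Complex.sub_re, Complex.re_ofReal_mul, Complex.add_re,
      Complex.sub_re, Complex.log_re, hwre, Complex.re_ofReal_mul, h3, Complex.ofReal_re]
    simp
  rw [edgeKernel, Complex.norm_exp, ← hw, hre]
  refine Real.exp_le_exp.2 ?_
  have hmain : (ε ^ 3)⁻¹ * (Real.log ‖1 + w‖ - ε * a + ((ε * a) ^ 2 - (ε * v) ^ 2) / 2) ≤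
      5 - v ^ 2 + (4 * (a - 2) / (1 + 2 * ε) + (a - 2) ^ 2 / ε) := by
    rw [inv_mul_le_iff₀ (by positivity)]
    have hv : (ε * v) ^ 2 / (1 + 2 * ε) ^ 2 / 2 - (ε * v) ^ 2 / 2 ≤ -(ε ^ 3 * v ^ 2) := by
      have : (ε * v) ^ 2 / (1 + 2 * ε) ^ 2 ≤ (ε * v) ^ 2 * (1 - 2 * ε) := by
        rw [div_le_iff₀ (by positivity), mul_assoc]
        refine le_mul_of_one_le_right (sq_nonneg _) ?_
        nlinarith [mul_nonneg hε.le hε.le]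
      linarith [(by ring : (ε * v) ^ 2 * (1 - 2 * ε) = (ε * v) ^ 2 - 2 * (ε ^ 3 * v ^ 2))]
    have ha' : ((1 + ε * a) ^ 2 / (1 + 2 * ε) ^ 2 - 1) / 2 =
        ε * (a - 2) / (1 + 2 * ε) + ε ^ 2 * (a - 2) ^ 2 / (1 + 2 * ε) ^ 2 / 2 := by
      field_simp; ring
    have ha2 : ε ^ 2 * (a - 2) ^ 2 / (1 + 2 * ε) ^ 2 ≤ ε ^ 2 * (a - 2) ^ 2 :=
      div_le_self (by positivity) (by nlinarith)
    have ha3 : ε * (a - 2) / (1 + 2 * ε) =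
        ε * (a - 2) - 2 * ε ^ 2 * (a - 2) + ε ^ 3 * (4 * (a - 2) / (1 + 2 * ε)) := by
      field_simp; ring
    have ha4 : ε ^ 3 * ((a - 2) ^ 2 / ε) = ε ^ 2 * (a - 2) ^ 2 := by field_simp
    have h5 : (2 * ε) ^ 3 / 3 + (2 * ε) ^ 5 ≤ ε ^ 3 * 5 := by
      have : ε ^ 2 ≤ 1 / 16 := by nlinarith
      nlinarith [pow_pos hε 3]
    rw [add_div] at hlog
    rw [mul_add, mul_sub, mul_add, ha4]
    nlinarith
  linarith

/-- On `Re z = 2` the kernel decays like the Airy kernel, for moderate `σ`. -/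
lemma norm_edgeKernel_two_le {ε : ℝ} (hε : 0 < ε) (hε' : ε ≤ 1 / 4) (σ v : ℝ) :
    ‖edgeKernel ε σ ((2 : ℝ) + v * Complex.I)‖ ≤
      Real.exp (5 - v ^ 2 - σ * 2 + ε * σ ^ 2 / 4) := by
  have := norm_edgeKernel_le hε hε' zero_le_two σ v
  simpa using this

/-- On the moving line `Re z = 2 + εσ/2` the kernel decays exponentially uniformly in `ε`. -/
lemma norm_edgeKernel_moving_le {ε σ : ℝ} (hε : 0 < ε) (hε' : ε ≤ 1 / 4) (hσ : 0 ≤ σ) (v : ℝ) :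
    ‖edgeKernel ε σ ((2 + ε * σ / 2 : ℝ) + v * Complex.I)‖ ≤
      Real.exp (5 - 3 / 2 * σ) * Real.exp (-1 * v ^ 2) := by
  refine (norm_edgeKernel_le hε hε' (by positivity) σ v).trans ?_
  rw [← Real.exp_add]
  refine Real.exp_le_exp.2 ?_
  have h1 : (2 + ε * σ / 2 - 2) ^ 2 / ε = ε * σ ^ 2 / 4 := by field_simp; ring
  have h2 : 4 * (2 + ε * σ / 2 - 2) / (1 + 2 * ε) ≤ σ / 2 := by
    rw [div_le_iff₀ (by positivity)]
    nlinarith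
  rw [h1]
  nlinarith

lemma norm_two_add_ge (v : ℝ) : 2 ≤ ‖((2 : ℝ) : ℂ) + v * Complex.I‖ := by
  have := Complex.re_le_norm (((2 : ℝ) : ℂ) + v * Complex.I)
  simpa using this

lemma quintic_majorant_fst {m t : ℝ} (hm : 2 ≤ m) (ht : 0 ≤ t) :
    m ^ 5 + m ^ 2 + m + (1 + t) ≤ 2 * m ^ 5 * (1 + t) := by
  have h1 : 8 ≤ m ^ 3 := by nlinarith [sq_nonneg m]
  have h2 : 8 * m ^ 2 ≤ m ^ 5 := by nlinarith [sq_nonneg m]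
  have h3 : 2 * m ≤ m ^ 2 := by nlinarith
  nlinarith [mul_nonneg (show 0 ≤ m ^ 5 - 1 by nlinarith) ht]

lemma quintic_majorant_snd {m t : ℝ} (hm : 2 ≤ m) (ht : 0 ≤ t) :
    m ^ 4 / 4 + 3 * m / 2 + t ^ 2 / 4 ≤ m ^ 5 * (1 + t) ^ 2 := by
  have h1 : 8 ≤ m ^ 3 := by nlinarith [sq_nonneg m]
  have h2 : 8 * m ≤ m ^ 4 := by nlinarith
  have h3 : 2 * m ^ 4 ≤ m ^ 5 := by nlinarith [sq_nonneg (m ^ 2)]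
  have h4 : 1 ≤ m ^ 5 := by linarith
  nlinarith [mul_nonneg (show 0 ≤ m ^ 5 - 1 by linarith) (sq_nonneg t), mul_nonneg
    (show 0 ≤ m ^ 5 by linarith) ht, sq_nonneg t]

set_option maxHeartbeats 800000 in
/-- Two-term expansion of the edge kernel on `Re z = 2`. -/
lemma norm_edgeKernel_sub_le {ε δ s : ℝ} (hε : 0 < ε) (hε' : ε ≤ 1 / 4) (hδ0 : 0 ≤ δ)
    (hδ : δ ≤ ε) (hδ' : |δ - ε / 2| ≤ ε ^ 4) (hs : ε * s ^ 2 ≤ 1) (v : ℝ) :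
    ‖edgeKernel ε (s + δ) ((2 : ℝ) + v * Complex.I) -
      Complex.exp (-s * ((2 : ℝ) + v * Complex.I)) * airyWeight v *
        (1 + ε * (-((2 : ℝ) + v * Complex.I) ^ 4 / 4 - 3 * ((2 : ℝ) + v * Complex.I) / 2 +
          s ^ 2 / 4))‖ ≤
      14 * ε ^ 2 * ‖((2 : ℝ) : ℂ) + v * Complex.I‖ ^ 10 * (1 + |s|) ^ 4 *
        Real.exp (6 - v ^ 2 - 2 * s) := by
  have hK := norm_edgeKernel_two_le hε hε' (s + δ) v
  have hm := norm_two_add_ge v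
  have hre : ((((2 : ℝ) : ℂ) + v * Complex.I)).re = 2 := by simp
  have hW := norm_airyWeight v
  rw [airyWeight] at hW ⊢
  rw [edgeKernel] at hK ⊢
  set z : ℂ := ((2 : ℝ) : ℂ) + v * Complex.I
  set m := ‖z‖
  set E := Real.exp (6 - v ^ 2 - 2 * s)
  set w : ℂ := ε * z with hw
  have hwn : ‖w‖ = ε * m := by rw [hw, norm_mul, Complex.norm_real, Real.norm_of_nonneg hε.le]
  have hw0 : 0 ≤ w.re := by rw [hw, Complex.re_ofReal_mul, hre]; positivity
  have hεc : (ε : ℂ) ≠ 0 := by exact_mod_cast hε.ne'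
  set R₁ : ℂ := Complex.log (1 + w) - w + w ^ 2 / 2 - w ^ 3 / 3 + w ^ 4 / 4 with hR₁
  set R₂ : ℂ := Complex.log (1 + w) - w with hR₂
  have hR₁n : ‖R₁‖ ≤ ε ^ 5 * m ^ 5 := by
    rw [← mul_pow, ← hwn]; exact norm_log_one_add_sub_le hw0
  have hR₂n : ‖R₂‖ ≤ ε ^ 2 * m ^ 2 := by
    rw [← mul_pow, ← hwn]; exact norm_log_one_add_sub_self_le hw0
  set A₁ : ℂ := ε * (-z ^ 4 / 4 - 3 * z / 2 + s ^ 2 / 4) with hA₁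
  set D : ℂ := ((ε ^ 3)⁻¹ : ℝ) * R₁ - R₂ - ((δ - ε / 2 : ℝ) : ℂ) * z +
    ((ε * (δ * (2 * s + δ)) / 4 : ℝ) : ℂ) with hD
  set B : ℂ := -s * z + z ^ 3 / 3 with hB
  have hexp : ((ε ^ 3)⁻¹ : ℝ) * (Complex.log (1 + w) - w + w ^ 2 / 2) - Complex.log (1 + w) -
      ((s + δ : ℝ) : ℂ) * z + ((ε * (s + δ) ^ 2 / 4 : ℝ) : ℂ) = B + (A₁ + D) := by
    rw [hB, hA₁, hD, hR₁, hR₂, hw]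
    push_cast
    field_simp
    ring
  rw [hexp] at hK ⊢
  rw [← Complex.exp_add, ← hB]
  have hBn : ‖Complex.exp B‖ ≤ E := by
    rw [hB, Complex.exp_add, norm_mul, hW, Complex.norm_exp, ← Complex.ofReal_neg,
      Complex.re_ofReal_mul, hre, ← Real.exp_add, ← Real.exp_add]
    refine Real.exp_le_exp.2 ?_
    nlinarith [sq_nonneg v]
  have hKE : ‖Complex.exp B‖ * ‖Complex.exp (A₁ + D)‖ ≤ E := by
    rw [← norm_mul, ← Complex.exp_add]
    refine hK.trans (Real.exp_le_exp.2 ?_)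
    have : ε * δ ^ 2 ≤ 1 := by
      have : δ ≤ 1 := by linarith
      nlinarith [sq_nonneg δ]
    nlinarith [mul_nonneg hε.le (sq_nonneg (s - δ))]
  have hs0 := abs_nonneg s
  have hDn : ‖D‖ ≤ 2 * ε ^ 2 * m ^ 5 * (1 + |s|) := by
    have e1 : ‖(((ε ^ 3)⁻¹ : ℝ) : ℂ) * R₁‖ ≤ ε ^ 2 * m ^ 5 := by
      rw [norm_mul, Complex.norm_real, Real.norm_of_nonneg (by positivity),
        inv_mul_le_iff₀ (by positivity)]
      exact hR₁n.trans_eq (by ring)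
    have e2 : ‖((δ - ε / 2 : ℝ) : ℂ) * z‖ ≤ ε ^ 2 * m := by
      rw [norm_mul, Complex.norm_real, Real.norm_eq_abs]
      refine mul_le_mul_of_nonneg_right (hδ'.trans ?_) (norm_nonneg _)
      exact pow_le_pow_of_le_one hε.le (by linarith) (by norm_num)
    have e3 : ‖((ε * (δ * (2 * s + δ)) / 4 : ℝ) : ℂ)‖ ≤ ε ^ 2 * (1 + |s|) := by
      rw [Complex.norm_real, Real.norm_eq_abs, abs_div, abs_mul, abs_mul, abs_of_pos hε,
        abs_of_nonneg hδ0, abs_of_pos (show (0 : ℝ) < 4 by norm_num)]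
      have : |2 * s + δ| ≤ 4 * (1 + |s|) := by
        refine (abs_add_le _ _).trans ?_
        rw [abs_mul, abs_of_nonneg hδ0, abs_of_pos (show (0 : ℝ) < 2 by norm_num)]
        linarith
      calc ε * (δ * |2 * s + δ|) / 4 ≤ ε * (ε * (4 * (1 + |s|))) / 4 := by gcongr
        _ = _ := by ring
    have e4 : ‖D‖ ≤ ε ^ 2 * m ^ 5 + ε ^ 2 * m ^ 2 + ε ^ 2 * m + ε ^ 2 * (1 + |s|) := by
      refine (norm_add_le _ _).trans (add_le_add ((norm_sub_le _ _).trans (add_le_add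
        ((norm_sub_le _ _).trans (add_le_add e1 hR₂n)) e2)) e3)
    refine e4.trans ?_
    have e7 := quintic_majorant_fst hm hs0
    calc _ = ε ^ 2 * (m ^ 5 + m ^ 2 + m + (1 + |s|)) := by ring
      _ ≤ ε ^ 2 * (2 * m ^ 5 * (1 + |s|)) := by gcongr
      _ = _ := by ring
  have hA₁n : ‖A₁‖ ≤ ε * m ^ 5 * (1 + |s|) ^ 2 := by
    rw [hA₁, norm_mul, Complex.norm_real, Real.norm_of_nonneg hε.le, mul_assoc]
    refine mul_le_mul_of_nonneg_left ?_ hε.le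
    have e1 : ‖-z ^ 4 / 4 - 3 * z / 2 + s ^ 2 / 4‖ ≤ m ^ 4 / 4 + 3 * m / 2 + |s| ^ 2 / 4 := by
      refine (norm_add_le _ _).trans (add_le_add ((norm_sub_le _ _).trans (add_le_add ?_ ?_)) ?_)
      · simp [m]
      · simp [m]
      · simp
    exact e1.trans (quintic_majorant_snd hm hs0)
  have hAn : ‖A₁ + D‖ ≤ 2 * (ε * m ^ 5 * (1 + |s|) ^ 2) := by
    have e1 : 2 * ε ^ 2 * m ^ 5 * (1 + |s|) ≤ ε * m ^ 5 * (1 + |s|) ^ 2 := by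
      calc _ = ε * m ^ 5 * (1 + |s|) * (2 * ε) := by ring
        _ ≤ ε * m ^ 5 * (1 + |s|) * (1 + |s|) := by gcongr; linarith
        _ = _ := by ring
    linarith [norm_add_le A₁ D]
  have hT := norm_exp_sub_one_sub_le (A₁ + D)
  have hfac : Complex.exp (B + (A₁ + D)) - Complex.exp B * (1 + A₁) =
      Complex.exp B * (Complex.exp (A₁ + D) - 1 - (A₁ + D)) + Complex.exp B * D := by
    rw [Complex.exp_add]; ring
  have hE0 : 0 ≤ E := (Real.exp_pos _).le
  have hA2 : ‖A₁ + D‖ ^ 2 ≤ 4 * (ε ^ 2 * m ^ 10 * (1 + |s|) ^ 4) :=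
    (pow_le_pow_left₀ (norm_nonneg _) hAn 2).trans_eq (by ring)
  have hD2 : ‖D‖ ≤ 2 * (ε ^ 2 * m ^ 10 * (1 + |s|) ^ 4) := by
    refine hDn.trans ?_
    have h1 : m ^ 5 ≤ m ^ 10 := pow_le_pow_right₀ (by linarith) (by norm_num)
    have h2 : 1 + |s| ≤ (1 + |s|) ^ 4 := le_self_pow₀ (by linarith) (by norm_num)
    calc _ ≤ 2 * ε ^ 2 * m ^ 10 * (1 + |s|) ^ 4 := by gcongr
      _ = _ := by ring
  rw [hfac]
  refine (norm_add_le _ _).trans ?_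
  rw [norm_mul, norm_mul]
  calc _ ≤ ‖Complex.exp B‖ * (‖A₁ + D‖ ^ 2 * (2 + ‖Complex.exp (A₁ + D)‖)) +
        ‖Complex.exp B‖ * ‖D‖ := by gcongr
    _ = ‖A₁ + D‖ ^ 2 * (2 * ‖Complex.exp B‖ + ‖Complex.exp B‖ * ‖Complex.exp (A₁ + D)‖) +
        ‖Complex.exp B‖ * ‖D‖ := by ring
    _ ≤ 4 * (ε ^ 2 * m ^ 10 * (1 + |s|) ^ 4) * (2 * E + E) +
        E * (2 * (ε ^ 2 * m ^ 10 * (1 + |s|) ^ 4)) := by gcongr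
    _ = _ := by ring

lemma continuous_edgeKernel_vertical {ε a : ℝ} (hε : 0 ≤ ε) (ha : 0 ≤ a) (σ : ℝ) :
    Continuous fun v : ℝ => edgeKernel ε σ (a + v * Complex.I) := by
  have hlog : Continuous fun v : ℝ => Complex.log (1 + ε * (a + v * Complex.I)) := by
    refine Continuous.clog (by fun_prop) fun v => one_add_mem_slitPlane ?_
    simp
    positivity
  unfold edgeKernel
  fun_prop

/-- Edge asymptotics of the contour integral for `|s| ≤ ε^{-1/2}`. -/
lemma exists_norm_integral_edgeKernel_sub_le : ∃ C, 0 ≤ C ∧ ∀ ε δ s : ℝ, 0 < ε → ε ≤ 1 / 4 →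
    0 ≤ δ → δ ≤ ε → |δ - ε / 2| ≤ ε ^ 4 → ε * s ^ 2 ≤ 1 →
    ‖(∫ v : ℝ, edgeKernel ε (s + δ) ((2 : ℝ) + v * Complex.I)) -
      (airyMoment 0 s - ε * airyMoment 1 s)‖ ≤
      C * ε ^ 2 * (1 + |s|) ^ 4 * Real.exp (-(2 * s)) := by
  have hgauss : Integrable fun v : ℝ => Real.exp (-(1 / 2) * v ^ 2) :=
    integrable_exp_neg_mul_sq (by norm_num)
  refine ⟨14 * Real.exp 6 * (10 : ℕ).factorial * Real.exp (|2| + 1 / (4 * (1 / 2))) *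
    ∫ v : ℝ, Real.exp (-(1 / 2) * v ^ 2), ?_, ?_⟩
  · have : 0 ≤ ∫ v : ℝ, Real.exp (-(1 / 2) * v ^ 2) := integral_nonneg fun v => (Real.exp_pos _).le
    positivity
  intro ε δ s hε hε' hδ0 hδ hδ' hs
  set G : ℕ → ℝ → ℂ := fun k v => (((2 : ℝ) : ℂ) + v * Complex.I) ^ k *
    Complex.exp (-s * (((2 : ℝ) : ℂ) + v * Complex.I)) * airyWeight v with hG
  have hGi : ∀ k, Integrable (G k) := fun k => integrable_airyMoment k s
  have hGm : ∀ k, ∫ v, G k v = airyMoment k s := fun k => rfl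
  set F : ℝ → ℂ := fun v => Complex.exp (-s * ((2 : ℝ) + v * Complex.I)) * airyWeight v *
        (1 + ε * (-((2 : ℝ) + v * Complex.I) ^ 4 / 4 - 3 * ((2 : ℝ) + v * Complex.I) / 2 +
          s ^ 2 / 4)) with hF
  have hFG : F = fun v => (1 + ε * s ^ 2 / 4) * G 0 v - ε * 3 / 2 * G 1 v - ε / 4 * G 4 v := by
    ext v
    simp only [hF, hG]
    ring
  have hFi : Integrable F := by
    rw [hFG]
    exact (((hGi 0).const_mul _).sub ((hGi 1).const_mul _)).sub ((hGi 4).const_mul _)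
  have hFm : ∫ v, F v = airyMoment 0 s - ε * airyMoment 1 s := by
    rw [hFG]
    rw [integral_sub (f := fun v => (1 + ε * s ^ 2 / 4) * G 0 v - ε * 3 / 2 * G 1 v) (((hGi 0).const_mul _).sub ((hGi 1).const_mul _)) ((hGi 4).const_mul _),
      integral_sub ((hGi 0).const_mul _) ((hGi 1).const_mul _), integral_const_mul,
      integral_const_mul, integral_const_mul, hGm, hGm, hGm, airyMoment_four]
    ring
  set c := 14 * ε ^ 2 * (10 : ℕ).factorial * Real.exp (|2| + 1 / (4 * (1 / 2))) * (1 + |s|) ^ 4 *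
    Real.exp 6 * Real.exp (-(2 * s))
  have hbound : ∀ v : ℝ, ‖edgeKernel ε (s + δ) ((2 : ℝ) + v * Complex.I) - F v‖ ≤
      c * Real.exp (-(1 / 2) * v ^ 2) := fun v => by
    refine (norm_edgeKernel_sub_le hε hε' hδ0 hδ hδ' hs v).trans ?_
    have h1 := norm_vertical_pow_le 2 (show (0 : ℝ) < 1 / 2 by norm_num) 10 v
    have h2 : Real.exp (6 - v ^ 2 - 2 * s) * Real.exp (1 / 2 * v ^ 2) =
        Real.exp 6 * Real.exp (-(2 * s)) * Real.exp (-(1 / 2) * v ^ 2) := by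
      simp only [← Real.exp_add]
      congr 1
      ring
    calc _ ≤ 14 * ε ^ 2 * ((10 : ℕ).factorial * Real.exp (|2| + 1 / (4 * (1 / 2))) *
          Real.exp (1 / 2 * v ^ 2)) * (1 + |s|) ^ 4 * Real.exp (6 - v ^ 2 - 2 * s) := by gcongr
      _ = 14 * ε ^ 2 * ((10 : ℕ).factorial * Real.exp (|2| + 1 / (4 * (1 / 2)))) * (1 + |s|) ^ 4 *
          (Real.exp (6 - v ^ 2 - 2 * s) * Real.exp (1 / 2 * v ^ 2)) := by ring
      _ = _ := by rw [h2]; ring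
  have hdi : Integrable fun v : ℝ => edgeKernel ε (s + δ) ((2 : ℝ) + v * Complex.I) - F v :=
    (hgauss.const_mul c).mono'
      ((continuous_edgeKernel_vertical hε.le zero_le_two _).aestronglyMeasurable.sub
        hFi.aestronglyMeasurable) (.of_forall hbound)
  have hKi : Integrable fun v : ℝ => edgeKernel ε (s + δ) ((2 : ℝ) + v * Complex.I) := by
    exact (hdi.add hFi).congr (.of_forall fun v => sub_add_cancel _ _)
  rw [← hFm, ← integral_sub hKi hFi]
  refine (norm_integral_le_of_norm_le (hgauss.const_mul c) (.of_forall hbound)).trans_eq ?_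
  rw [integral_const_mul]
  ring

lemma inv_two_pi_le_one : (2 * π)⁻¹ ≤ 1 := inv_le_one_of_one_le₀ (by linarith [Real.two_le_pi])

lemma inv_two_pi_nonneg : 0 ≤ (2 * π)⁻¹ := by positivity

lemma exists_abs_re_airyMoment_le (k : ℕ) :
    ∃ C, 0 ≤ C ∧ ∀ s, |(2 * π)⁻¹ * (airyMoment k s).re| ≤ C * Real.exp (-(2 * s)) := by
  obtain ⟨C, hC, h⟩ := exists_norm_airyMoment_le k
  refine ⟨C, hC, fun s => ?_⟩
  rw [abs_mul, abs_of_nonneg inv_two_pi_nonneg]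
  calc _ ≤ 1 * ‖airyMoment k s‖ :=
        mul_le_mul inv_two_pi_le_one (Complex.abs_re_le_norm _) (abs_nonneg _) zero_le_one
    _ ≤ _ := by rw [one_mul, mul_comm 2 s, ← neg_mul]; exact h s

lemma one_add_abs_pow_four_mul_exp_le {sL s : ℝ} (hs : sL ≤ s) :
    (1 + |s|) ^ 4 * Real.exp (-(2 * s)) ≤ 24 * Real.exp (1 + 2 * |sL|) * Real.exp (-s) := by
  have h1 := Real.pow_div_factorial_le_exp (1 + |s|) (by positivity) 4
  rw [div_le_iff₀ (by positivity)] at h1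
  have h2 : |s| ≤ s + 2 * |sL| := abs_le.2
    ⟨by linarith [neg_abs_le sL], by linarith [abs_nonneg sL]⟩
  calc (1 + |s|) ^ 4 * Real.exp (-(2 * s))
      ≤ Real.exp (1 + (s + 2 * |sL|)) * 24 * Real.exp (-(2 * s)) := by
        gcongr
        refine h1.trans ?_
        norm_num [Nat.factorial]
        linarith
    _ = 24 * (Real.exp (1 + (s + 2 * |sL|)) * Real.exp (-(2 * s))) := by ring
    _ = _ := by
        rw [mul_assoc, ← Real.exp_add, ← Real.exp_add]
        ring_nf

lemma exp_neg_le_of_one_le {ε s : ℝ} (hs : 0 ≤ s) (h : 1 ≤ ε * s ^ 2) :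
    Real.exp (-(3 / 2 * s)) ≤ 384 * ε ^ 2 * Real.exp (-s) := by
  have h1 := Real.pow_div_factorial_le_exp (s / 2) (by positivity) 4
  norm_num [Nat.factorial] at h1
  have h2 : 1 ≤ ε ^ 2 * s ^ 4 := (one_le_pow₀ h (n := 2)).trans_eq (by ring)
  have h3 : 1 ≤ 384 * ε ^ 2 * Real.exp (s / 2) := by
    nlinarith [sq_nonneg ε]
  calc Real.exp (-(3 / 2 * s)) ≤ 384 * ε ^ 2 * Real.exp (s / 2) * Real.exp (-(3 / 2 * s)) :=
        le_mul_of_one_le_left (Real.exp_pos _).le h3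
    _ = 384 * ε ^ 2 * (Real.exp (s / 2) * Real.exp (-(3 / 2 * s))) := by ring
    _ = _ := by rw [← Real.exp_add]; ring_nf

/-- Exponential decay of the rescaled wave function, uniform in `N`. -/
lemma exists_abs_psiTauR_le : ∃ C, 0 ≤ C ∧ ∀ N : ℕ, N ≠ 0 → epsN N ≤ 1 / 4 → ∀ s, 0 ≤ s →
    |psiTauR N s| ≤ C * Real.exp (-(3 / 2 * s)) := by
  have hgauss : Integrable fun v : ℝ => Real.exp (-1 * v ^ 2) :=
    integrable_exp_neg_mul_sq (by norm_num)
  refine ⟨Real.exp 5 * ∫ v : ℝ, Real.exp (-1 * v ^ 2), ?_, fun N hN hε' s hs => ?_⟩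
  · have : 0 ≤ ∫ v : ℝ, Real.exp (-1 * v ^ 2) := integral_nonneg fun v => (Real.exp_pos _).le
    positivity
  have hε := epsN_pos hN
  obtain ⟨hδ0, -, -⟩ := shiftN_bounds hN
  have hσ : 0 ≤ s + shiftN N := by positivity
  rw [psiTauR_eq (a := 2 + epsN N * (s + shiftN N) / 2) hN (by positivity)
    (sqrt_eq_add_tauN_mul_shiftN hN), abs_mul, abs_of_nonneg
    (mul_nonneg (kappaN_nonneg N) inv_two_pi_nonneg)]
  have h1 : kappaN N * (2 * π)⁻¹ ≤ 1 :=
    mul_le_one₀ (kappaN_le_one hN) inv_two_pi_nonneg inv_two_pi_le_one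
  refine (mul_le_of_le_one_left (abs_nonneg _) h1).trans ((Complex.abs_re_le_norm _).trans ?_)
  refine (norm_integral_le_of_norm_le (hgauss.const_mul (Real.exp (5 - 3 / 2 * (s + shiftN N))))
    (.of_forall fun v => norm_edgeKernel_moving_le hε hε' hσ v)).trans ?_
  rw [integral_const_mul, mul_right_comm, ← Real.exp_add]
  refine mul_le_mul_of_nonneg_right (Real.exp_le_exp.2 (by linarith))
    (integral_nonneg fun v => (Real.exp_pos _).le)

/-- Pointwise edge asymptotics `ψ_τ = Ai + ε Ai' + O(ε² e^{-s})`. -/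
lemma exists_abs_psiTauR_sub_le (sL : ℝ) : ∃ C, 0 ≤ C ∧ ∀ N : ℕ, N ≠ 0 → epsN N ≤ 1 / 4 →
    epsN N * sL ^ 2 ≤ 1 → ∀ s, sL ≤ s →
    |psiTauR N s - (Ai s - epsN N * ((2 * π)⁻¹ * (airyMoment 1 s).re))| ≤
      C * epsN N ^ 2 * Real.exp (-s) := by
  obtain ⟨C₀, hC₀, h₀⟩ := exists_abs_re_airyMoment_le 0
  obtain ⟨C₁, hC₁, h₁⟩ := exists_abs_re_airyMoment_le 1
  obtain ⟨C₂, hC₂, h₂⟩ := exists_abs_psiTauR_le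
  obtain ⟨C₃, hC₃, h₃⟩ := exists_norm_integral_edgeKernel_sub_le
  refine ⟨(C₃ + C₀ + C₁) * (24 * Real.exp (1 + 2 * |sL|)) + (C₂ + C₀ + C₁) * 384, by positivity,
    fun N hN hε' hsL s hs => ?_⟩
  have hε := epsN_pos hN
  obtain ⟨hδ0, hδ, hδ'⟩ := shiftN_bounds hN
  have hT : |Ai s - epsN N * ((2 * π)⁻¹ * (airyMoment 1 s).re)| ≤
      (C₀ + C₁) * Real.exp (-(2 * s)) := by
    rw [Ai_eq_airyMoment, add_mul]
    refine (abs_sub _ _).trans (add_le_add (h₀ s) ?_)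
    rw [abs_mul, abs_of_pos hε]
    exact (mul_le_of_le_one_left (abs_nonneg _) (by linarith)).trans (h₁ s)
  rcases le_or_gt (epsN N * s ^ 2) 1 with hmod | hlarge
  · have hK := h₃ _ _ s hε hε' hδ0 hδ hδ' hmod
    set J := ∫ v : ℝ, edgeKernel (epsN N) (s + shiftN N) ((2 : ℝ) + v * Complex.I) with hJ
    set T := Ai s - epsN N * ((2 * π)⁻¹ * (airyMoment 1 s).re) with hTdef
    have hTeq : T = (2 * π)⁻¹ * (airyMoment 0 s - epsN N * airyMoment 1 s).re := by
      rw [hTdef, Ai_eq_airyMoment, Complex.sub_re, Complex.re_ofReal_mul]; ring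
    have hPT : |(2 * π)⁻¹ * J.re - T| ≤
        C₃ * epsN N ^ 2 * (1 + |s|) ^ 4 * Real.exp (-(2 * s)) := by
      rw [hTeq, ← mul_sub, ← Complex.sub_re, abs_mul, abs_of_nonneg inv_two_pi_nonneg]
      exact (mul_le_of_le_one_left (abs_nonneg _) inv_two_pi_le_one).trans
        ((Complex.abs_re_le_norm _).trans hK)
    have hκ0 := kappaN_nonneg N
    have hκ1 := kappaN_le_one hN
    have hκ : 1 - kappaN N ≤ epsN N ^ 2 := by
      refine (one_sub_kappaN_le hN).trans ?_
      rw [← epsN_pow_three]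
      exact pow_le_pow_of_le_one hε.le (by linarith) (by norm_num)
    have hψ : psiTauR N s - T = kappaN N * ((2 * π)⁻¹ * J.re - T) - (1 - kappaN N) * T := by
      rw [psiTauR_eq (a := 2) hN (by positivity) (sqrt_eq_add_tauN_mul_shiftN hN), ← hJ]; ring
    have hexp := one_add_abs_pow_four_mul_exp_le hs
    have h1s : 1 ≤ (1 + |s|) ^ 4 := one_le_pow₀ (by linarith [abs_nonneg s])
    rw [hψ]
    refine (abs_sub _ _).trans ?_
    rw [abs_mul, abs_mul, abs_of_nonneg hκ0, abs_of_nonneg (sub_nonneg.2 hκ1)]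
    calc _ ≤ 1 * (C₃ * epsN N ^ 2 * (1 + |s|) ^ 4 * Real.exp (-(2 * s))) +
          epsN N ^ 2 * ((C₀ + C₁) * ((1 + |s|) ^ 4 * Real.exp (-(2 * s)))) := by
          gcongr
          exact hT.trans (mul_le_mul_of_nonneg_left
            (le_mul_of_one_le_left (Real.exp_pos _).le h1s) (by positivity))
      _ = (C₃ + C₀ + C₁) * epsN N ^ 2 * ((1 + |s|) ^ 4 * Real.exp (-(2 * s))) := by ring
      _ ≤ (C₃ + C₀ + C₁) * epsN N ^ 2 * (24 * Real.exp (1 + 2 * |sL|) * Real.exp (-s)) := by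
          gcongr
      _ ≤ (C₃ + C₀ + C₁) * epsN N ^ 2 * (24 * Real.exp (1 + 2 * |sL|) * Real.exp (-s)) +
          (C₂ + C₀ + C₁) * 384 * epsN N ^ 2 * Real.exp (-s) :=
          le_add_of_nonneg_right (by positivity)
      _ = _ := by ring
  · have hs0 : 0 ≤ s := by
      by_contra! hneg
      have : s ^ 2 ≤ sL ^ 2 := by nlinarith
      exact hlarge.not_ge ((mul_le_mul_of_nonneg_left this hε.le).trans hsL)
    have hexp := exp_neg_le_of_one_le hs0 hlarge.le
    have h2s : Real.exp (-(2 * s)) ≤ Real.exp (-(3 / 2 * s)) := Real.exp_le_exp.2 (by linarith)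
    refine (abs_sub _ _).trans ((add_le_add (h₂ N hN hε' s hs0) hT).trans ?_)
    calc _ ≤ C₂ * Real.exp (-(3 / 2 * s)) + (C₀ + C₁) * Real.exp (-(3 / 2 * s)) := by gcongr
      _ = (C₂ + C₀ + C₁) * Real.exp (-(3 / 2 * s)) := by ring
      _ ≤ (C₂ + C₀ + C₁) * (384 * epsN N ^ 2 * Real.exp (-s)) := by gcongr
      _ ≤ (C₂ + C₀ + C₁) * (384 * epsN N ^ 2 * Real.exp (-s)) +
          (C₃ + C₀ + C₁) * (24 * Real.exp (1 + 2 * |sL|)) * epsN N ^ 2 * Real.exp (-s) :=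
          le_add_of_nonneg_right (by positivity)
      _ = _ := by ring

lemma continuous_psiTauR (N : ℕ) : Continuous (psiTauR N) := by
  have h : Continuous (iteratedDeriv (N - 1) fun t : ℝ => Real.exp (-t ^ 2)) :=
    ContDiff.continuous_iteratedDeriv' _ (by fun_prop)
  unfold psiTauR osc physHermite
  fun_prop

lemma tendsto_epsN : Tendsto epsN atTop (nhds 0) := by
  have := (tendsto_rpow_neg_atTop (show (0 : ℝ) < 1 / 3 by norm_num)).comp
    tendsto_natCast_atTop_atTop
  refine this.congr fun N => ?_
  simp [epsN, neg_div]

/-- Integrability over a half-line under the majorant `C e^{-u}`. -/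
lemma integrableOn_of_abs_le_exp {f : ℝ → ℝ} {C s : ℝ} (hf : Continuous f)
    (h : ∀ u, s ≤ u → |f u| ≤ C * Real.exp (-u)) : IntegrableOn f (Set.Ioi s) :=
  ((integrableOn_exp_neg_Ioi s).const_mul C).mono' hf.aestronglyMeasurable
    (ae_restrict_of_forall_mem measurableSet_Ioi fun u hu => h u (le_of_lt hu))

lemma abs_integral_Ioi_le_exp {f : ℝ → ℝ} {C s : ℝ}
    (h : ∀ u, s ≤ u → |f u| ≤ C * Real.exp (-u)) :
    |∫ u in Set.Ioi s, f u| ≤ C * Real.exp (-s) := by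
  refine (norm_integral_le_of_norm_le (f := f) ((integrableOn_exp_neg_Ioi s).const_mul C)
    (ae_restrict_of_forall_mem measurableSet_Ioi fun u hu => h u (le_of_lt hu))).trans_eq ?_
  rw [integral_const_mul, integral_exp_neg_Ioi]

/-- Right-tail integrals: `∫_s^∞ ψ_τ = ∫_s^∞ Ai - Δ_N Ai(s) + O(N^{-2/3} e^{-s/2})` and
`|∫_s^∞ ψ_τ| ≤ C e^{-s}`, the improper integrals being convergent. -/
theorem orthogonal_tail_integral_bounds (sL : ℝ) :
    ∃ C > 0, ∃ N₀ : ℕ, ∀ N : ℕ, N₀ ≤ N → ∀ s : ℝ, sL ≤ s →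
      IntegrableOn (psiTauR N) (Set.Ioi s) ∧
      IntegrableOn Ai (Set.Ioi s) ∧
      |(∫ u in Set.Ioi s, psiTauR N u) - (∫ u in Set.Ioi s, Ai u) + DeltaN N * Ai s| ≤
        C * (N : ℝ) ^ (-(2 : ℝ) / 3) * Real.exp (-s / 2) ∧
      |∫ u in Set.Ioi s, psiTauR N u| ≤ C * Real.exp (-s) := by
  obtain ⟨C₀, hC₀, h₀⟩ := exists_abs_re_airyMoment_le 0
  obtain ⟨C₁, hC₁, h₁⟩ := exists_abs_re_airyMoment_le 1
  obtain ⟨C₂, hC₂, h₂⟩ := exists_abs_psiTauR_sub_le sL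
  set D : ℝ → ℝ := fun s => -((2 * π)⁻¹ * (airyMoment 1 s).re) with hD
  have hAi : ∀ s, HasDerivAt Ai (D s) s := hasDerivAt_Ai
  have hAic : Continuous Ai := continuous_iff_continuousAt.2 fun s => (hAi s).continuousAt
  have hDc : Continuous D := by
    have : Continuous (airyMoment 1) :=
      continuous_iff_continuousAt.2 fun s => (hasDerivAt_airyMoment 1 s).continuousAt
    fun_prop
  have hexp : ∀ u, sL ≤ u → Real.exp (-(2 * u)) ≤ Real.exp (-sL) * Real.exp (-u) := fun u hu => by
    rw [← Real.exp_add]; exact Real.exp_le_exp.2 (by linarith)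
  have hAib : ∀ u, sL ≤ u → |Ai u| ≤ C₀ * Real.exp (-sL) * Real.exp (-u) := fun u hu => by
    rw [Ai_eq_airyMoment, mul_assoc]
    exact (h₀ u).trans (mul_le_mul_of_nonneg_left (hexp u hu) hC₀)
  have hDb : ∀ u, sL ≤ u → |D u| ≤ C₁ * Real.exp (-sL) * Real.exp (-u) := fun u hu => by
    rw [hD, abs_neg, mul_assoc]
    exact (h₁ u).trans (mul_le_mul_of_nonneg_left (hexp u hu) hC₁)
  have hev : ∀ᶠ N : ℕ in atTop, N ≠ 0 ∧ epsN N ≤ 1 / 4 ∧ epsN N * sL ^ 2 ≤ 1 := by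
    have h : Tendsto (fun N => epsN N * sL ^ 2) atTop (nhds 0) := by
      simpa using tendsto_epsN.mul_const (sL ^ 2)
    exact (eventually_ne_atTop 0).and ((tendsto_epsN.eventually_le_const (by norm_num)).and
      (h.eventually_le_const one_pos))
  obtain ⟨N₀, hN₀⟩ := eventually_atTop.1 hev
  set a := C₀ * Real.exp (-sL) with ha
  set b := C₁ * Real.exp (-sL) with hb
  have ha0 : 0 ≤ a := by positivity
  have hb0 : 0 ≤ b := by positivity
  refine ⟨(C₂ + 2 * a) * Real.exp (-sL / 2) + (C₂ + a + b) + 1, by positivity, N₀,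
    fun N hN s hs => ?_⟩
  obtain ⟨hN0, hε', hsL⟩ := hN₀ N hN
  have hε := epsN_pos hN0
  have hdiff : ∀ u, s ≤ u → |psiTauR N u - Ai u - epsN N * D u| ≤
      C₂ * epsN N ^ 2 * Real.exp (-u) := fun u hu => by
    convert h₂ N hN0 hε' hsL u (hs.trans hu) using 2
    ring
  have hψb : ∀ u, s ≤ u → |psiTauR N u| ≤ (C₂ + a + b) * Real.exp (-u) := fun u hu => by
    have e1 : |epsN N * D u| ≤ b * Real.exp (-u) := by
      rw [abs_mul, abs_of_pos hε]
      exact (mul_le_of_le_one_left (abs_nonneg _) (by linarith)).trans (hDb u (hs.trans hu))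
    have e2 : C₂ * epsN N ^ 2 * Real.exp (-u) ≤ C₂ * Real.exp (-u) :=
      mul_le_mul_of_nonneg_right (mul_le_of_le_one_right hC₂
        (pow_le_one₀ hε.le (by linarith))) (Real.exp_pos _).le
    calc |psiTauR N u| = |(psiTauR N u - Ai u - epsN N * D u) + Ai u + epsN N * D u| := by
          congr 1; ring
      _ ≤ C₂ * Real.exp (-u) + a * Real.exp (-u) + b * Real.exp (-u) :=
          (abs_add_three _ _ _).trans (add_le_add (add_le_add ((hdiff u hu).trans e2)
            (hAib u (hs.trans hu))) e1)
      _ = _ := by ring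
  have hψi := integrableOn_of_abs_le_exp (continuous_psiTauR N) hψb
  have hAii := integrableOn_of_abs_le_exp hAic fun u hu => hAib u (hs.trans hu)
  have hDi := integrableOn_of_abs_le_exp hDc fun u hu => hDb u (hs.trans hu)
  refine ⟨hψi, hAii, ?_, ?_⟩
  · have hDint : ∫ u in Set.Ioi s, D u = -Ai s := by
      rw [integral_Ioi_of_hasDerivAt_of_tendsto' (fun u _ => hAi u) hDi
        (tendsto_zero_of_hasDerivAt_of_integrableOn_Ioi (fun u _ => hAi u) hDi hAii), zero_sub]
    have hint : ∫ u in Set.Ioi s, (psiTauR N u - Ai u - epsN N * D u) =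
        (∫ u in Set.Ioi s, psiTauR N u) - (∫ u in Set.Ioi s, Ai u) + epsN N * Ai s := by
      rw [integral_sub (f := fun u => psiTauR N u - Ai u) (hψi.sub hAii) (hDi.const_mul _), integral_sub hψi hAii,
        integral_const_mul, hDint]
      ring
    have hmain := abs_integral_Ioi_le_exp hdiff
    rw [hint] at hmain
    have hΔ : |(DeltaN N - epsN N) * Ai s| ≤ 2 * epsN N ^ 2 * (a * Real.exp (-s)) := by
      rw [abs_mul]
      refine mul_le_mul ((abs_DeltaN_sub_le hN0).trans ?_) (hAib s hs) (abs_nonneg _)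
        (by positivity)
      exact mul_le_mul_of_nonneg_left (pow_le_pow_of_le_one hε.le (by linarith) (by norm_num))
        zero_le_two
    have hexps : Real.exp (-s) ≤ Real.exp (-sL / 2) * Real.exp (-s / 2) := by
      rw [← Real.exp_add]; exact Real.exp_le_exp.2 (by linarith)
    rw [← epsN_sq]
    calc _ = |((∫ u in Set.Ioi s, psiTauR N u) - (∫ u in Set.Ioi s, Ai u) + epsN N * Ai s) +
          (DeltaN N - epsN N) * Ai s| := by congr 1; ring
      _ ≤ C₂ * epsN N ^ 2 * Real.exp (-s) + 2 * epsN N ^ 2 * (a * Real.exp (-s)) :=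
          (abs_add_le _ _).trans (add_le_add hmain hΔ)
      _ = (C₂ + 2 * a) * epsN N ^ 2 * Real.exp (-s) := by ring
      _ ≤ (C₂ + 2 * a) * epsN N ^ 2 * (Real.exp (-sL / 2) * Real.exp (-s / 2)) := by gcongr
      _ = (C₂ + 2 * a) * Real.exp (-sL / 2) * epsN N ^ 2 * Real.exp (-s / 2) := by ring
      _ ≤ _ := by
          gcongr
          linarith
  · refine (abs_integral_Ioi_le_exp hψb).trans ?_
    refine mul_le_mul_of_nonneg_right ?_ (Real.exp_pos _).le
    have : 0 ≤ (C₂ + 2 * a) * Real.exp (-sL / 2) := by positivity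
    linarith
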